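/- arXiv:1302.2873 — 6 statements merged into one kernel-verified Lean document; each statement's English description precedes it below -/
import Mathlib

section
/- Let γ ≥ −1 and α ≥ 0. If f belongs to the space C_γ, then the Riemann–Liouville fractional integral I^α f belongs to the space C_{α+γ}; in particular, I^α maps C_γ into itself. -/
open Real MeasureTheory Filter Set Topology

/-- The Riemann–Liouville fractional integral `I^α` (with `I^0 f = f`). -/
noncomputable def RL (α : ℝ) (f : ℝ → ℝ) : ℝ → ℝ :=
  if α = 0 then f
  else fun x => (1 / Real.Gamma α) * ∫ t in (0:ℝ)..x, (x - t) ^ (α - 1) * f t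

/-- The space `C_γ`: `f x = x ^ p * f₁ x` on `(0,∞)` for some `p > γ` and `f₁`
continuous on `[0,∞)`. -/
def SpaceC (γ : ℝ) (f : ℝ → ℝ) : Prop :=
  ∃ p : ℝ, γ < p ∧ ∃ f₁ : ℝ → ℝ,
    ContinuousOn f₁ (Set.Ici 0) ∧ ∀ x > 0, f x = x ^ p * f₁ x

/-- The space `C^m_γ`: `f` is `m` times differentiable on `(0,∞)` and `f^(m) ∈ C_γ`. -/
def SpaceCm (m : ℕ) (γ : ℝ) (f : ℝ → ℝ) : Prop :=
  (∀ k < m, DifferentiableOn ℝ (iteratedDerivWithin k f (Set.Ioi 0)) (Set.Ioi 0)) ∧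
  SpaceC γ (iteratedDerivWithin m f (Set.Ioi 0))

/-- The Laplace convolution `(f ⋆ g) x = ∫_0^x f (x - t) * g t dt`. -/
noncomputable def laplaceConv (f g : ℝ → ℝ) : ℝ → ℝ :=
  fun x => ∫ t in (0:ℝ)..x, f (x - t) * g t

/-- The generalized Riemann–Liouville (Hilfer) fractional derivative of order `α`
(`n - 1 < α ≤ n`) and type `β`. -/
noncomputable def hilferD (n : ℕ) (α β : ℝ) (f : ℝ → ℝ) : ℝ → ℝ :=
  RL (β * (n - α)) (iteratedDerivWithin n (RL ((1 - β) * (n - α)) f) (Set.Ioi 0))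

/-- The space `Ω^α_β` (for `n - 1 < α ≤ n`): `y ∈ C_{-1}` with
`I^{(1-β)(n-α)} y ∈ C^n_{-1}`. -/
def OmegaSpace (n : ℕ) (α β : ℝ) (y : ℝ → ℝ) : Prop :=
  SpaceC (-1) y ∧ SpaceCm n (-1) (RL ((1 - β) * (n - α)) y)

/-- The multivariate Mittag-Leffler function
`E_{(a_1,…,a_n),b}(z_1,…,z_n)`, with the double series
`Σ_k Σ_{l_1+⋯+l_n=k}` rewritten as a sum over all multi-indices. -/
noncomputable def mittagLeffler {n : ℕ} (a : Fin n → ℝ) (b : ℝ) (z : Fin n → ℝ) : ℝ :=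
  ∑' l : Fin n → ℕ,
    ((Nat.factorial (∑ j, l j) : ℝ) / ∏ j, (Nat.factorial (l j) : ℝ)) *
      (∏ j, z j ^ l j) / Real.Gamma (b + ∑ j, a j * l j)

theorem SpaceC.anti {γ δ : ℝ} (h : γ ≤ δ) {f : ℝ → ℝ} (hf : SpaceC δ f) : SpaceC γ f := by
  obtain ⟨p, hp, hf⟩ := hf
  exact ⟨p, h.trans_lt hp, hf⟩

/-- The weight `(1 - u) ^ (α - 1) * u ^ p` of the Beta integral is integrable on `[0, 1]`. -/
theorem intervalIntegrable_beta_weight {α p : ℝ} (hα : 0 < α) (hp : -1 < p) :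
    IntervalIntegrable (fun u : ℝ => (1 - u) ^ (α - 1) * u ^ p) volume 0 1 := by
  have hc := (Complex.betaIntegral_convergent (u := ((p + 1 : ℝ) : ℂ)) (v := (α : ℂ))
    (by rw [Complex.ofReal_re]; linarith) (by simpa using hα)).norm
  refine hc.congr_ae ?_
  have h1 : ∀ᵐ u : ℝ ∂(volume.restrict (uIoc (0 : ℝ) 1)), u ≠ 1 :=
    ae_restrict_of_ae (by simp [ae_iff])
  filter_upwards [h1, ae_restrict_mem measurableSet_uIoc] with u hu1 hu
  rw [uIoc_of_le zero_le_one] at hu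
  have h0 : 0 < 1 - u := sub_pos.2 (lt_of_le_of_ne hu.2 hu1)
  have e : (1 : ℂ) - u = ((1 - u : ℝ) : ℂ) := by push_cast; rfl
  rw [norm_mul, e, Complex.norm_cpow_eq_rpow_re_of_pos hu.1,
    Complex.norm_cpow_eq_rpow_re_of_pos h0, mul_comm]
  simp

/-- Averaging the dilates of a continuous function against an integrable weight yields a
continuous function of the dilation factor. -/
theorem continuous_integral_weight_mul_dilate {w g : ℝ → ℝ}
    (hw : IntervalIntegrable w volume 0 1) (hg : Continuous g) :
    Continuous fun x : ℝ => ∫ u in (0 : ℝ)..1, w u * g (x * u) := by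
  refine continuous_iff_continuousAt.2 fun x₀ => ?_
  obtain ⟨C, hC⟩ := (isCompact_Icc (a := -(|x₀| + 1)) (b := |x₀| + 1)).exists_bound_of_continuousOn
    hg.continuousOn
  refine intervalIntegral.continuousAt_of_dominated_interval (bound := fun u => ‖w u‖ * C)
    ?_ ?_ (hw.norm.mul_const C) ?_
  · exact Eventually.of_forall fun x => hw.def'.aestronglyMeasurable.mul
      (by fun_prop : Continuous fun u => g (x * u)).aestronglyMeasurable
  · have hx : ∀ᶠ x in 𝓝 x₀, |x| < |x₀| + 1 :=
      continuous_abs.continuousAt.eventually_lt continuousAt_const (by simp)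
    filter_upwards [hx] with x hx
    refine Eventually.of_forall fun u hu => ?_
    rw [uIoc_of_le zero_le_one] at hu
    rw [norm_mul]
    refine mul_le_mul_of_nonneg_left (hC _ (abs_le.1 ?_)) (norm_nonneg _)
    rw [abs_mul, abs_of_pos hu.1]
    nlinarith [abs_nonneg x, hu.2]
  · exact Eventually.of_forall fun u _ => by fun_prop

/-- The substitution `t = x * u` in the Riemann–Liouville integral. -/
theorem integral_rl_kernel_eq {α p x : ℝ} (hx : 0 < x) {f g : ℝ → ℝ}
    (hf : ∀ t > 0, f t = t ^ p * g t) :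
    ∫ t in (0 : ℝ)..x, (x - t) ^ (α - 1) * f t =
      x ^ (α + p) * ∫ u in (0 : ℝ)..1, ((1 - u) ^ (α - 1) * u ^ p) * g (x * u) := by
  have h := intervalIntegral.mul_integral_comp_mul_left (a := 0) (b := 1) (c := x)
    (f := fun t => (x - t) ^ (α - 1) * f t)
  rw [mul_zero, mul_one] at h
  rw [← h, ← intervalIntegral.integral_const_mul, ← intervalIntegral.integral_const_mul]
  refine intervalIntegral.integral_congr_ae (Eventually.of_forall fun u hu => ?_)
  rw [uIoc_of_le zero_le_one] at hu
  have e : x - x * u = x * (1 - u) := by ring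
  have hpow : x ^ (α + p) = x * x ^ (α - 1) * x ^ p := by
    rw [rpow_add hx, rpow_sub_one hx.ne', mul_div_cancel₀ _ hx.ne']
  rw [hf _ (mul_pos hx hu.1), e, mul_rpow hx.le (sub_nonneg.2 hu.2), mul_rpow hx.le hu.1.le, hpow]
  ring

/-- For `γ ≥ -1` and `α ≥ 0`, the Riemann–Liouville fractional integral
maps `C_γ` into `C_{α+γ} ⊆ C_γ`. -/
theorem rl_integral_maps_Cgamma (γ α : ℝ) (hγ : -1 ≤ γ) (hα : 0 ≤ α)
    (f : ℝ → ℝ) (hf : SpaceC γ f) :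
    SpaceC (α + γ) (RL α f) ∧ SpaceC γ (RL α f) := by
  suffices h : SpaceC (α + γ) (RL α f) from ⟨h, h.anti (by linarith)⟩
  rcases hα.eq_or_lt with rfl | hα
  · simpa [RL] using hf
  obtain ⟨p, hp, f₁, hf₁, hf⟩ := hf
  have hg : Continuous fun t => f₁ (max t 0) :=
    hf₁.comp_continuous (by fun_prop) fun t => le_max_right t 0
  refine ⟨α + p, by linarith, fun x => (1 / Real.Gamma α) *
    ∫ u in (0 : ℝ)..1, ((1 - u) ^ (α - 1) * u ^ p) * f₁ (max (x * u) 0), ?_, fun x hx => ?_⟩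
  · exact (continuous_const.mul (continuous_integral_weight_mul_dilate
      (intervalIntegrable_beta_weight hα (by linarith)) hg)).continuousOn
  · have hfg : ∀ t > 0, f t = t ^ p * f₁ (max t 0) := fun t ht => by
      rw [hf t ht, max_eq_left ht.le]
    simp only [RL, if_neg hα.ne']
    rw [integral_rl_kernel_eq hx (g := fun t => f₁ (max t 0)) hfg]
    ring
end

section
/- Let m ∈ ℕ₀, let f ∈ C^m_{−1} satisfy f(0+) = f'(0+) = ⋯ = f^{(m−1)}(0+) = 0, and let g ∈ C^1_{−1}. Then the Laplace convolution h(x) = ∫₀ˣ f(t) g(x−t) dt belongs to C^m_{−1} and satisfies h(0+) = h'(0+) = ⋯ = h^{(m)}(0+) = 0. -/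
open Real MeasureTheory Filter Set Topology

/-- A function in `C_{-1}` is integrable on every interval `(0, b]`. -/
lemma SpaceC.integrableOn_Ioc {u : ℝ → ℝ} (hu : SpaceC (-1) u) (b : ℝ) :
    IntegrableOn u (Ioc 0 b) := by
  obtain ⟨p, hp, u₁, hu₁, hu⟩ := hu
  rcases le_total b 0 with hb | hb
  · simp [Ioc_eq_empty_of_le hb]
  have hpow : IntegrableOn (fun x : ℝ => x ^ p) (Icc 0 b) :=
    (intervalIntegrable_iff_integrableOn_Icc_of_le hb).1
      (intervalIntegral.intervalIntegrable_rpow' hp)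
  refine ((hpow.mul_continuousOn (hu₁.mono Icc_subset_Ici_self) isCompact_Icc).mono_set
    Ioc_subset_Icc_self).congr_fun (fun x hx => (hu x hx.1).symm) measurableSet_Ioc

/-- A function continuous on `(0,∞)` with a finite limit at `0+` is in `C_{-1}`. -/
lemma SpaceC.of_tendsto {u : ℝ → ℝ} {l : ℝ} (hu : ContinuousOn u (Ioi 0))
    (h0 : Tendsto u (𝓝[>] 0) (𝓝 l)) : SpaceC (-1) u := by
  refine ⟨0, by norm_num, Function.update u 0 l, ?_, fun x hx => ?_⟩
  · rw [← Ioi_insert, continuousOn_update_iff]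
    simpa using ⟨hu, h0⟩
  · simp [Function.update_of_ne hx.ne']

/-- A function in `C^1_{-1}` agrees on `(0,∞)` with a function continuous on the whole line. -/
lemma SpaceCm.exists_continuous_eqOn {g : ℝ → ℝ} (hg : SpaceCm 1 (-1) g) :
    ∃ G : ℝ → ℝ, Continuous G ∧ EqOn g G (Ioi 0) := by
  obtain ⟨hd, hC⟩ := hg
  have hd0 : DifferentiableOn ℝ g (Ioi 0) := by simpa using hd 0 one_pos
  rw [iteratedDerivWithin_one] at hC
  set g' := derivWithin g (Ioi 0) with hg'
  have hint : ∀ a b, IntervalIntegrable ((Ioi 0).indicator g') volume a b := fun a b => by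
    rw [intervalIntegrable_iff, IntegrableOn, integrable_indicator_iff measurableSet_Ioi,
      IntegrableOn, Measure.restrict_restrict measurableSet_Ioi]
    exact (hC.integrableOn_Ioc (max a b)).mono_set fun x hx => ⟨hx.1, hx.2.2⟩
  refine ⟨fun x => g 1 + ∫ t in (1:ℝ)..x, (Ioi 0).indicator g' t,
    continuous_const.add (intervalIntegral.continuous_primitive hint 1), fun x hx => ?_⟩
  have hftc := intervalIntegral.integral_eq_sub_of_hasDerivAt (a := 1) (b := x) (f := g)
    (f' := (Ioi 0).indicator g') (fun y hy => ?_) (hint 1 x)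
  · simp only [hftc]; ring
  · have hy0 : y ∈ Ioi (0:ℝ) := lt_of_lt_of_le (lt_min one_pos hx) hy.1
    rw [indicator_of_mem hy0]
    exact (hd0 y hy0).hasDerivWithinAt.hasDerivAt (Ioi_mem_nhds hy0)

/-- For `x ≥ 0`, the Laplace convolution depends only on the values of its factors on `(0,∞)`. -/
lemma laplaceConv_congr {f₁ f₂ g₁ g₂ : ℝ → ℝ} (hf : EqOn f₁ f₂ (Ioi 0)) (hg : EqOn g₁ g₂ (Ioi 0)) :
    EqOn (laplaceConv f₁ g₁) (laplaceConv f₂ g₂) (Ici 0) := fun x hx => by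
  simp only [laplaceConv, intervalIntegral.integral_of_le hx.out, integral_Ioc_eq_integral_Ioo]
  refine setIntegral_congr_fun measurableSet_Ioo fun t ht => ?_
  simp only [hf (sub_pos.2 ht.2 : x - t ∈ Ioi 0), hg ht.1]

@[simp]
lemma laplaceConv_zero (f g : ℝ → ℝ) : laplaceConv f g 0 = 0 := by simp [laplaceConv]

/-- The Laplace convolution of a locally integrable function with a continuous one is continuous
on `[0,∞)`. -/
lemma continuousOn_laplaceConv {u G : ℝ → ℝ} (hu : ∀ b, IntegrableOn u (Ioc 0 b))
    (hG : Continuous G) : ContinuousOn (laplaceConv u G) (Ici 0) := by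
  suffices h : ∀ b, 0 ≤ b → ContinuousOn (laplaceConv u G) (Icc 0 b) by
    intro x hx
    refine (h (x + 1) (by linarith [hx.out]) x ⟨hx, by linarith⟩).mono_of_mem_nhdsWithin ?_
    rw [← Ici_inter_Iic]
    exact inter_mem_nhdsWithin _ (Iic_mem_nhds (by linarith))
  intro b hb
  have heq : EqOn (laplaceConv u G)
      (fun x => ∫ t in Ioc 0 b, (Iio x).indicator (fun t => u t * G (x - t)) t) (Icc 0 b) := by
    intro x hx
    have h := intervalIntegral.integral_comp_sub_left (a := 0) (b := x)
      (fun t => u t * G (x - t)) x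
    simp only [sub_sub_cancel, sub_self, sub_zero] at h
    simp only [laplaceConv]
    rw [h, intervalIntegral.integral_of_le hx.1, setIntegral_indicator measurableSet_Iio,
      integral_Ioc_eq_integral_Ioo]
    congr 2
    ext t
    exact ⟨fun ht => ⟨⟨ht.1, ht.2.le.trans hx.2⟩, ht.2⟩, fun ht => ⟨ht.1.1, ht.2⟩⟩
  refine ContinuousOn.congr (fun x₀ hx₀ => ?_) heq
  obtain ⟨C, hC⟩ := (isCompact_Icc (a := (0:ℝ)) (b := b)).exists_bound_of_continuousOn
    hG.continuousOn
  refine continuousWithinAt_of_dominated (bound := fun t => ‖u t‖ * C) ?_ ?_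
    ((hu b).norm.mul_const C) ?_
  · exact Eventually.of_forall fun x => (((hu b).aestronglyMeasurable.mul
      (hG.comp (continuous_const.sub continuous_id)).aestronglyMeasurable).indicator
        measurableSet_Iio)
  · filter_upwards [self_mem_nhdsWithin] with x hx
    filter_upwards [ae_restrict_mem measurableSet_Ioc] with t ht
    by_cases htx : t < x
    · rw [indicator_of_mem (mem_Iio.2 htx), norm_mul]
      gcongr
      exact hC _ ⟨by linarith, by linarith [hx.2, ht.1]⟩
    · rw [indicator_of_notMem (by simpa using htx), norm_zero]
      exact mul_nonneg (norm_nonneg _) ((norm_nonneg _).trans (hC 0 ⟨le_rfl, hb⟩))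
  · filter_upwards [Measure.ae_ne (volume.restrict (Ioc 0 b)) x₀] with t ht
    refine ContinuousAt.continuousWithinAt ?_
    rcases lt_or_gt_of_ne ht with ht | ht
    · have hc : Continuous fun x => u t * G (x - t) := by fun_prop
      refine hc.continuousAt.congr ?_
      filter_upwards [Ioi_mem_nhds ht] with x hx
      rw [indicator_of_mem (mem_Iio.2 hx)]
    · refine (continuousAt_const (y := (0:ℝ))).congr ?_
      filter_upwards [Iio_mem_nhds ht] with x hx
      rw [indicator_of_notMem (by simpa using hx.out.le)]

/-- If `f` is the primitive of `u` vanishing at `0+`, then `f ⋆ G` is the primitive of `u ⋆ G`. -/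
lemma laplaceConv_primitive {f u G : ℝ → ℝ} (hu : ∀ b, IntegrableOn u (Ioc 0 b))
    (hG : Continuous G) (hf : ∀ x > 0, f x = ∫ t in (0:ℝ)..x, u t) {x : ℝ} (hx : 0 ≤ x) :
    laplaceConv f G x = ∫ s in (0:ℝ)..x, laplaceConv u G s := by
  set U := (Ioc 0 x).indicator u with hU
  have hUint : Integrable U := (integrable_indicator_iff measurableSet_Ioc).2 (hu x)
  have hVint : Integrable ((Ioc 0 x).indicator G) :=
    (integrable_indicator_iff measurableSet_Ioc).2
      ((hG.integrableOn_Icc (a := 0) (b := x)).mono_set Ioc_subset_Icc_self)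
  have hprod : Integrable (Function.uncurry fun s t => U (s - t) * (Ioc 0 x).indicator G t)
      ((volume.restrict (Ioc 0 x)).prod (volume.restrict (Ioc 0 x))) := by
    rw [Measure.prod_restrict]
    refine ((hVint.convolution_integrand (ContinuousLinearMap.mul ℝ ℝ) hUint
      (μ := volume)).congr (ae_of_all _ fun p => ?_)).restrict
    simp [Function.uncurry, mul_comm]
  have hswap := integral_integral_swap hprod
  have hleft : ∫ s in Ioc 0 x, ∫ t in Ioc 0 x, U (s - t) * (Ioc 0 x).indicator G t =
      ∫ s in Ioc 0 x, laplaceConv u G s := by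
    refine setIntegral_congr_fun measurableSet_Ioc fun s hs => ?_
    simp only [laplaceConv, intervalIntegral.integral_of_le hs.1.le, integral_Ioc_eq_integral_Ioo]
    have hset : Ioo 0 s = Ioc 0 x ∩ Iio s := by
      ext t
      exact ⟨fun ht => ⟨⟨ht.1, ht.2.le.trans hs.2⟩, ht.2⟩, fun ht => ⟨ht.1.1, ht.2⟩⟩
    rw [hset, ← setIntegral_indicator measurableSet_Iio, ← integral_Ioc_eq_integral_Ioo]
    refine setIntegral_congr_fun measurableSet_Ioc fun t ht => ?_
    by_cases hts : t < s
    · have hmem : s - t ∈ Ioc 0 x := ⟨by linarith, by linarith [hs.2, ht.1]⟩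
      simp [hU, indicator_of_mem hmem, indicator_of_mem ht, hts]
    · have hmem : s - t ∉ Ioc 0 x := fun h => hts (by linarith [h.1])
      simp only [hU, indicator_of_notMem hmem, zero_mul,
        indicator_of_notMem (show t ∉ Iio s from hts)]
  have hright : ∫ t in Ioc 0 x, ∫ s in Ioc 0 x, U (s - t) * (Ioc 0 x).indicator G t =
      laplaceConv f G x := by
    simp only [laplaceConv, intervalIntegral.integral_of_le hx]
    rw [integral_Ioc_eq_integral_Ioo, integral_Ioc_eq_integral_Ioo]
    refine setIntegral_congr_fun measurableSet_Ioo fun t ht => ?_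
    have hinner : ∫ s in Ioc 0 x, U (s - t) = f (x - t) := by
      rw [hf _ (sub_pos.2 ht.2), ← intervalIntegral.integral_of_le hx,
        intervalIntegral.integral_comp_sub_right, intervalIntegral.integral_of_le (by linarith),
        intervalIntegral.integral_of_le (by linarith [ht.2]), hU,
        setIntegral_indicator measurableSet_Ioc]
      congr 2
      ext y
      simp only [mem_inter_iff, mem_Ioc]
      constructor
      · rintro ⟨h1, h2⟩; exact ⟨h2.1, h1.2⟩
      · rintro ⟨h1, h2⟩; exact ⟨⟨by linarith [ht.1], h2⟩, h1, by linarith [ht.1]⟩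
    simp only [integral_mul_const, hinner, indicator_of_mem (Ioo_subset_Ioc_self ht)]
  rw [intervalIntegral.integral_of_le hx, ← hleft, hswap, hright]

/-- If `f` is the primitive of `u` vanishing at `0+`, then `(f ⋆ G)' = u ⋆ G` on `(0,∞)`. -/
lemma hasDerivAt_laplaceConv {f u G : ℝ → ℝ} (hu : ∀ b, IntegrableOn u (Ioc 0 b))
    (hG : Continuous G) (hf : ∀ x > 0, f x = ∫ t in (0:ℝ)..x, u t) {x : ℝ} (hx : 0 < x) :
    HasDerivAt (laplaceConv f G) (laplaceConv u G x) x := by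
  have hcont := continuousOn_laplaceConv hu hG
  have hderiv := intervalIntegral.integral_hasDerivAt_right (a := 0) (b := x)
    ((hcont.mono (by rw [uIcc_of_le hx.le]; exact Icc_subset_Ici_self)).intervalIntegrable)
    ((hcont.mono Ioi_subset_Ici_self).stronglyMeasurableAtFilter isOpen_Ioi x hx)
    (hcont.continuousAt (Ici_mem_nhds hx))
  refine hderiv.congr_of_eventuallyEq ?_
  filter_upwards [Ioi_mem_nhds hx] with y hy
  exact laplaceConv_primitive hu hG hf hy.out.le

/-- A differentiable function on `(0,∞)` that vanishes at `0+` is the primitive of its derivative,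
if the latter is integrable near `0`. -/
lemma eq_integral_derivWithin_Ioi {f : ℝ → ℝ} (hd : DifferentiableOn ℝ f (Ioi 0))
    (h0 : Tendsto f (𝓝[>] 0) (𝓝 0))
    (hint : ∀ b, IntegrableOn (derivWithin f (Ioi 0)) (Ioc 0 b)) :
    ∀ x > 0, f x = ∫ t in (0:ℝ)..x, derivWithin f (Ioi 0) t := fun x hx => by
  have h := intervalIntegral.integral_eq_sub_of_hasDerivAt_of_tendsto hx
    (fun y hy => (hd y hy.1).hasDerivWithinAt.hasDerivAt (Ioi_mem_nhds hy.1))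
    ((intervalIntegrable_iff_integrableOn_Ioc_of_le hx.le).2 (hint x)) h0
    ((hd.continuousOn.continuousAt (Ioi_mem_nhds hx)).tendsto.mono_left nhdsWithin_le_nhds)
  rw [h, sub_zero]

/-- Under the hypotheses of `laplaceConv_mem_Cm`, every derivative of `f` is in `C_{-1}`. -/
lemma SpaceCm.spaceC_iteratedDerivWithin {m : ℕ} {f : ℝ → ℝ} (hf : SpaceCm m (-1) f)
    (hf0 : ∀ k < m, Tendsto (iteratedDerivWithin k f (Ioi 0)) (𝓝[>] (0:ℝ)) (𝓝 0))
    {k : ℕ} (hk : k ≤ m) : SpaceC (-1) (iteratedDerivWithin k f (Ioi 0)) := by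
  rcases hk.lt_or_eq with hk | rfl
  · exact .of_tendsto (hf.1 k hk).continuousOn (hf0 k hk)
  · exact hf.2

/-- The derivatives of a Laplace convolution fall on the factor whose derivatives vanish at `0+`. -/
lemma iteratedDerivWithin_laplaceConv {m : ℕ} {f g G : ℝ → ℝ} (hf : SpaceCm m (-1) f)
    (hf0 : ∀ k < m, Tendsto (iteratedDerivWithin k f (Ioi 0)) (𝓝[>] (0:ℝ)) (𝓝 0))
    (hG : Continuous G) (hgG : EqOn g G (Ioi 0)) {k : ℕ} (hk : k ≤ m) :
    EqOn (iteratedDerivWithin k (laplaceConv f g) (Ioi 0))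
      (laplaceConv (iteratedDerivWithin k f (Ioi 0)) G) (Ioi 0) := by
  induction k with
  | zero =>
    simpa using (laplaceConv_congr (eqOn_refl f _) hgG).mono Ioi_subset_Ici_self
  | succ k ih =>
    intro x hx
    have hint := (hf.spaceC_iteratedDerivWithin hf0 hk).integrableOn_Ioc
    rw [iteratedDerivWithin_succ] at hint ⊢
    rw [derivWithin_congr (ih (by lia)) (ih (by lia) hx), iteratedDerivWithin_succ]
    exact ((hasDerivAt_laplaceConv hint hG (eq_integral_derivWithin_Ioi (hf.1 k hk) (hf0 k hk) hint)
      hx).hasDerivWithinAt).derivWithin (uniqueDiffOn_Ioi 0 x hx)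

/-- if `f ∈ C^m_{-1}` with `f(0+) = ⋯ = f^{(m-1)}(0+) = 0` and `g ∈ C^1_{-1}`,
then the Laplace convolution `h = f ⋆ g` is in `C^m_{-1}` with `h(0+) = ⋯ = h^{(m)}(0+) = 0`. -/
theorem laplaceConv_mem_Cm (m : ℕ) (f g : ℝ → ℝ) (hf : SpaceCm m (-1) f)
    (hf0 : ∀ k < m,
      Tendsto (iteratedDerivWithin k f (Set.Ioi 0)) (𝓝[>] (0:ℝ)) (𝓝 0))
    (hg : SpaceCm 1 (-1) g) :
    SpaceCm m (-1) (laplaceConv f g) ∧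
    ∀ k ≤ m,
      Tendsto (iteratedDerivWithin k (laplaceConv f g) (Set.Ioi 0)) (𝓝[>] (0:ℝ)) (𝓝 0) := by
  obtain ⟨G, hG, hgG⟩ := hg.exists_continuous_eqOn
  have hint : ∀ k ≤ m, ∀ b, IntegrableOn (iteratedDerivWithin k f (Ioi 0)) (Ioc 0 b) :=
    fun k hk => (hf.spaceC_iteratedDerivWithin hf0 hk).integrableOn_Ioc
  have hcont : ∀ k ≤ m,
      ContinuousOn (laplaceConv (iteratedDerivWithin k f (Ioi 0)) G) (Ici 0) :=
    fun k hk => continuousOn_laplaceConv (hint k hk) hG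
  have heq : ∀ k ≤ m, EqOn (iteratedDerivWithin k (laplaceConv f g) (Ioi 0))
      (laplaceConv (iteratedDerivWithin k f (Ioi 0)) G) (Ioi 0) :=
    fun k hk => iteratedDerivWithin_laplaceConv hf hf0 hG hgG hk
  refine ⟨⟨fun k hk => ?_, 0, by norm_num, _, hcont m le_rfl, fun x hx => ?_⟩, fun k hk => ?_⟩
  · refine DifferentiableOn.congr (fun x hx => ?_) (heq k hk.le)
    have hint' := hint (k + 1) hk
    rw [iteratedDerivWithin_succ] at hint'
    exact (hasDerivAt_laplaceConv hint' hG (eq_integral_derivWithin_Ioi (hf.1 k hk) (hf0 k hk)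
      hint') hx).differentiableAt.differentiableWithinAt
  · rw [heq m le_rfl hx, rpow_zero, one_mul]
  · have h := ((hcont k hk) 0 self_mem_Ici).mono Ioi_subset_Ici_self
    rw [ContinuousWithinAt, laplaceConv_zero] at h
    exact h.congr' (by filter_upwards [self_mem_nhdsWithin] with x hx using (heq k hk hx).symm)
end

section
/- Let n − 1 < α ≤ n ∈ ℕ, 0 ≤ β ≤ 1, and let y belong to the space Ω^α_β. Then for all x > 0, (I^α (D^{α,β} y))(x) = y(x) − Σ_{k=0}^{n−1} [x^{k−n+α−βα+βn} / Γ(k−n+α−βα+βn+1)] · (d^k/dx^k)(I^{(1−β)(n−α)} y)(0+). -/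
open Real MeasureTheory Filter Set Topology

theorem SpaceC.exists_continuous {γ : ℝ} {f : ℝ → ℝ} (hf : SpaceC γ f) :
    ∃ p : ℝ, γ < p ∧ ∃ f₁ : ℝ → ℝ, Continuous f₁ ∧ ∀ x > 0, f x = x ^ p * f₁ x := by
  obtain ⟨p, hp, f₁, hf₁, h⟩ := hf
  refine ⟨p, hp, fun x => f₁ (max x 0),
    hf₁.comp_continuous (by fun_prop) fun x => le_max_right x 0, fun x hx => ?_⟩
  simp only [max_eq_left hx.le, h x hx]

theorem SpaceC.congr {γ : ℝ} {f g : ℝ → ℝ} (hf : SpaceC γ f) (h : ∀ x > 0, g x = f x) :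
    SpaceC γ g := by
  obtain ⟨p, hp, f₁, hf₁, hfx⟩ := hf
  exact ⟨p, hp, f₁, hf₁, fun x hx => (h x hx).trans (hfx x hx)⟩

theorem spaceC_rpow {γ p : ℝ} (hp : γ < p) : SpaceC γ fun x => x ^ p :=
  ⟨p, hp, fun _ => 1, continuousOn_const, fun x _ => by simp⟩

theorem SpaceC.const_mul {γ : ℝ} {f : ℝ → ℝ} (hf : SpaceC γ f) (c : ℝ) :
    SpaceC γ fun x => c * f x := by
  obtain ⟨p, hp, f₁, hf₁, h⟩ := hf
  exact ⟨p, hp, fun x => c * f₁ x, continuousOn_const.mul hf₁, fun x hx => by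
    simp only [h x hx]; ring⟩

theorem SpaceC.add {γ : ℝ} {f g : ℝ → ℝ} (hf : SpaceC γ f) (hg : SpaceC γ g) :
    SpaceC γ fun x => f x + g x := by
  obtain ⟨p, hp, f₁, hf₁, hf⟩ := hf
  obtain ⟨q, hq, g₁, hg₁, hg⟩ := hg
  have hcont : ∀ r : ℝ, 0 ≤ r → ContinuousOn (fun x : ℝ => x ^ r) (Ici 0) := fun r hr =>
    (Real.continuous_rpow_const hr).continuousOn
  refine ⟨min p q, lt_min hp hq, fun x => x ^ (p - min p q) * f₁ x + x ^ (q - min p q) * g₁ x,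
    ((hcont _ (by simp)).mul hf₁).add ((hcont _ (by simp)).mul hg₁), fun x hx => ?_⟩
  beta_reduce
  rw [hf x hx, hg x hx, mul_add, ← mul_assoc, ← mul_assoc, ← rpow_add hx, ← rpow_add hx]
  simp

theorem spaceC_sum {γ : ℝ} {f : ℕ → ℝ → ℝ} (n : ℕ) (hf : ∀ k < n, SpaceC γ (f k)) :
    SpaceC γ fun x => ∑ k ∈ Finset.range n, f k x := by
  induction n with
  | zero => exact ⟨γ + 1, by simp, fun _ => 0, continuousOn_const, fun x _ => by simp⟩
  | succ n ih =>
    simp_rw [Finset.sum_range_succ]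
    exact (ih fun k hk => hf k (by omega)).add (hf n (by omega))

theorem SpaceC.abs {γ : ℝ} {f : ℝ → ℝ} (hf : SpaceC γ f) : SpaceC γ fun x => |f x| := by
  obtain ⟨p, hp, f₁, hf₁, h⟩ := hf
  exact ⟨p, hp, fun x => |f₁ x|, hf₁.abs, fun x hx => by
    simp only [h x hx, abs_mul, abs_of_pos (rpow_pos_of_pos hx p)]⟩

theorem SpaceC.continuousOn {γ : ℝ} {f : ℝ → ℝ} (hf : SpaceC γ f) : ContinuousOn f (Ioi 0) := by
  obtain ⟨p, -, f₁, hf₁, h⟩ := hf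
  refine ContinuousOn.congr (f := fun x => x ^ p * f₁ x) ?_ h
  exact (ContinuousOn.rpow_const continuousOn_id fun x hx => Or.inl (ne_of_gt hx)).mul
    (hf₁.mono Ioi_subset_Ici_self)

theorem intervalIntegrable_sub_rpow_mul_rpow {a p x : ℝ} (ha : 0 < a) (hp : -1 < p) (hx : 0 < x) :
    IntervalIntegrable (fun t => (x - t) ^ (a - 1) * t ^ p) volume 0 x := by
  have key : ∀ r s : ℝ, -1 < r →
      IntervalIntegrable (fun t => (x - t) ^ s * t ^ r) volume 0 (x / 2) := fun r s hr => by
    refine (intervalIntegral.intervalIntegrable_rpow' hr).continuousOn_mul ?_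
    refine ContinuousOn.rpow_const (by fun_prop) fun t ht => Or.inl ?_
    rw [uIcc_of_le (by positivity)] at ht
    linarith [ht.2]
  refine (key p (a - 1) hp).trans ?_
  have h := (key (a - 1) p (by linarith)).comp_sub_left x
  rw [sub_zero, sub_half] at h
  exact h.symm.congr fun t _ => by simp [mul_comm]

theorem SpaceC.intervalIntegrable_kernel_mul {f : ℝ → ℝ} (hf : SpaceC (-1) f) {a x : ℝ}
    (ha : 0 < a) (hx : 0 < x) :
    IntervalIntegrable (fun t => (x - t) ^ (a - 1) * f t) volume 0 x := by
  obtain ⟨p, hp, f₁, hf₁, h⟩ := hf.exists_continuous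
  refine ((intervalIntegrable_sub_rpow_mul_rpow ha hp hx).mul_continuousOn
    hf₁.continuousOn).congr fun t ht => ?_
  rw [uIoc_of_le hx.le] at ht
  simp only [h t ht.1, mul_assoc]

theorem SpaceC.intervalIntegrable {f : ℝ → ℝ} (hf : SpaceC (-1) f) {x : ℝ} (hx : 0 < x) :
    IntervalIntegrable f volume 0 x := by
  simpa using hf.intervalIntegrable_kernel_mul one_pos hx

theorem RL_zero (f : ℝ → ℝ) : RL 0 f = f := by simp [RL]

theorem RL_of_pos {a : ℝ} (ha : 0 < a) (f : ℝ → ℝ) (x : ℝ) :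
    RL a f x = 1 / Gamma a * ∫ t in (0 : ℝ)..x, (x - t) ^ (a - 1) * f t := by
  simp [RL, ha.ne']

theorem RL_one (f : ℝ → ℝ) (x : ℝ) : RL 1 f x = ∫ t in (0 : ℝ)..x, f t := by
  simp [RL]

theorem RL_congr {f g : ℝ → ℝ} (h : ∀ x > 0, f x = g x) (a : ℝ) {x : ℝ} (hx : 0 < x) :
    RL a f x = RL a g x := by
  unfold RL
  split_ifs
  · exact h x hx
  · refine congrArg (1 / Gamma a * ·) ?_
    refine intervalIntegral.integral_congr_ae (Eventually.of_forall fun t ht => ?_)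
    rw [uIoc_of_le hx.le] at ht
    rw [h t ht.1]

theorem RL_const_mul (a c : ℝ) (f : ℝ → ℝ) (x : ℝ) :
    RL a (fun t => c * f t) x = c * RL a f x := by
  unfold RL
  split_ifs
  · rfl
  · simp_rw [mul_left_comm _ c, intervalIntegral.integral_const_mul]
    ring

theorem RL_add {f g : ℝ → ℝ} (hf : SpaceC (-1) f) (hg : SpaceC (-1) g) {a x : ℝ} (ha : 0 ≤ a)
    (hx : 0 < x) : RL a (fun t => f t + g t) x = RL a f x + RL a g x := by
  rcases ha.eq_or_lt with rfl | ha
  · simp [RL]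
  · simp_rw [RL_of_pos ha, mul_add]
    rw [intervalIntegral.integral_add (hf.intervalIntegrable_kernel_mul ha hx)
      (hg.intervalIntegrable_kernel_mul ha hx), mul_add]

theorem RL_sum {f : ℕ → ℝ → ℝ} (n : ℕ) (hf : ∀ k < n, SpaceC (-1) (f k)) {a x : ℝ}
    (ha : 0 ≤ a) (hx : 0 < x) :
    RL a (fun t => ∑ k ∈ Finset.range n, f k t) x = ∑ k ∈ Finset.range n, RL a (f k) x := by
  induction n with
  | zero => simp [RL]
  | succ n ih =>
    simp_rw [Finset.sum_range_succ]
    rw [RL_add (spaceC_sum n fun k hk => hf k (by omega)) (hf n (by omega)) ha hx,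
      ih fun k hk => hf k (by omega)]

theorem RL_eq_rpow_mul_integral {f f₁ : ℝ → ℝ} {p : ℝ} (h : ∀ x > 0, f x = x ^ p * f₁ x)
    {a x : ℝ} (ha : 0 < a) (hx : 0 < x) :
    RL a f x = x ^ (a + p) *
      (1 / Gamma a * ∫ s in (0 : ℝ)..1, (1 - s) ^ (a - 1) * s ^ p * f₁ (x * s)) := by
  have hsub := intervalIntegral.smul_integral_comp_mul_left (a := 0) (b := 1)
    (fun t => (x - t) ^ (a - 1) * f t) x
  rw [mul_zero, mul_one] at hsub
  rw [RL_of_pos ha, ← hsub, smul_eq_mul, mul_left_comm (x ^ (a + p)),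
    ← intervalIntegral.integral_const_mul x, ← intervalIntegral.integral_const_mul (x ^ (a + p))]
  refine congrArg (1 / Gamma a * ·) ?_
  refine intervalIntegral.integral_congr_ae (Eventually.of_forall fun s hs => ?_)
  rw [uIoc_of_le zero_le_one] at hs
  have hx1 : x ^ (a + p) = x * x ^ (a - 1) * x ^ p := by
    rw [mul_comm x, rpow_sub_one hx.ne', div_mul_cancel₀ _ hx.ne', rpow_add hx]
  rw [h _ (mul_pos hx hs.1), show x - x * s = x * (1 - s) by ring,
    mul_rpow hx.le (by linarith [hs.2]), mul_rpow hx.le hs.1.le, hx1]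
  ring

theorem SpaceC.RL {f : ℝ → ℝ} (hf : SpaceC (-1) f) {a : ℝ} (ha : 0 ≤ a) :
    SpaceC (-1) (RL a f) := by
  rcases ha.eq_or_lt with rfl | ha
  · rwa [RL_zero]
  obtain ⟨p, hp, f₁, hf₁, h⟩ := hf.exists_continuous
  refine ⟨a + p, by linarith,
    fun x => 1 / Gamma a * ∫ s in (0 : ℝ)..1, (1 - s) ^ (a - 1) * s ^ p * f₁ (x * s),
    ?_, fun x hx => RL_eq_rpow_mul_integral h ha hx⟩
  refine (continuous_const.mul (continuous_iff_continuousAt.2 fun x₀ => ?_)).continuousOn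
  have hbeta := intervalIntegrable_sub_rpow_mul_rpow ha hp one_pos
  obtain ⟨C, hC⟩ := (isCompact_Icc (a := -(|x₀| + 1)) (b := |x₀| + 1)).exists_bound_of_continuousOn
    hf₁.continuousOn
  refine intervalIntegral.continuousAt_of_dominated_interval
    (bound := fun s => ‖(1 - s) ^ (a - 1) * s ^ p‖ * C)
    (Eventually.of_forall fun x => ?_) ?_ (hbeta.norm.mul_const C)
    (Eventually.of_forall fun s _ => by fun_prop)
  · exact (hbeta.mul_continuousOn (g := fun s => f₁ (x * s))
      (by fun_prop)).aestronglyMeasurable_restrict_uIoc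
  · filter_upwards [Metric.ball_mem_nhds x₀ one_pos] with x hx
    refine Eventually.of_forall fun s hs => ?_
    rw [uIoc_of_le zero_le_one] at hs
    rw [norm_mul]
    gcongr
    refine hC _ (abs_le.1 ?_)
    rw [Metric.mem_ball, Real.dist_eq] at hx
    rw [abs_mul, abs_of_pos hs.1]
    nlinarith [abs_sub_abs_le_abs_sub x x₀, abs_nonneg x, hs.2]

theorem integral_one_sub_rpow_mul_rpow {a p : ℝ} (ha : 0 < a) (hp : -1 < p) :
    ∫ s in (0 : ℝ)..1, (1 - s) ^ (a - 1) * s ^ p =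
      Gamma a * Gamma (p + 1) / Gamma (a + p + 1) := by
  have hp' : 0 < p + 1 := by linarith
  have h := Complex.betaIntegral_eq_Gamma_mul_div (p + 1 : ℝ) (a : ℝ) (by simpa using hp')
    (by simpa using ha)
  rw [← Complex.ofReal_add, Complex.Gamma_ofReal, Complex.Gamma_ofReal, Complex.Gamma_ofReal,
    Complex.betaIntegral] at h
  rw [← Complex.ofReal_inj, ← intervalIntegral.integral_ofReal, mul_comm (Gamma a),
    show a + p + 1 = p + 1 + a by ring, Complex.ofReal_div, Complex.ofReal_mul, ← h]
  refine intervalIntegral.integral_congr_ae (Eventually.of_forall fun s hs => ?_)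
  rw [uIoc_of_le zero_le_one] at hs
  rw [Complex.ofReal_mul, Complex.ofReal_cpow hs.1.le, Complex.ofReal_cpow (by linarith [hs.2])]
  push_cast
  rw [add_sub_cancel_right, mul_comm]

theorem RL_rpow_div_Gamma {a p x : ℝ} (ha : 0 ≤ a) (hp : -1 < p) (hx : 0 < x) :
    RL a (fun t => t ^ p / Gamma (p + 1)) x = x ^ (a + p) / Gamma (a + p + 1) := by
  rcases ha.eq_or_lt with rfl | ha
  · simp [RL]
  have hΓa := (Gamma_pos_of_pos ha).ne'
  have hΓp := (Gamma_pos_of_pos (show 0 < p + 1 by linarith)).ne'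
  rw [RL_eq_rpow_mul_integral (f₁ := fun _ => 1 / Gamma (p + 1))
      (fun t _ => div_eq_mul_one_div _ _) ha hx,
    intervalIntegral.integral_mul_const, integral_one_sub_rpow_mul_rpow ha hp]
  field_simp

/-- The kernel of the Riemann–Liouville integral of order `a`, extended by zero. -/
noncomputable def RLKernel (a : ℝ) : ℝ → ℝ :=
  (Ioi 0).indicator fun t => t ^ (a - 1) / Gamma a

theorem indicator_RL_eq_convolution {a : ℝ} (ha : 0 < a) (f : ℝ → ℝ) :
    (Ioi 0).indicator (RL a f) =
      convolution ((Ioi 0).indicator f) (RLKernel a) (ContinuousLinearMap.mul ℝ ℝ) volume := by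
  rw [RLKernel, ← posConvolution_eq_convolution_indicator _ _ _ volume, posConvolution]
  congr 1
  ext x
  rw [RL_of_pos ha, ← intervalIntegral.integral_const_mul]
  refine intervalIntegral.integral_congr fun t _ => ?_
  simp only [ContinuousLinearMap.mul_apply']
  ring

theorem SpaceC.convolutionExistsAt {f : ℝ → ℝ} (hf : SpaceC (-1) f) {a : ℝ} (ha : 0 < a) (x : ℝ) :
    ConvolutionExistsAt ((Ioi 0).indicator f) (RLKernel a) x (ContinuousLinearMap.mul ℝ ℝ)
      volume := by
  have heq : (fun t => ContinuousLinearMap.mul ℝ ℝ ((Ioi 0).indicator f t) (RLKernel a (x - t))) =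
      (Ioo 0 x).indicator fun t => 1 / Gamma a * ((x - t) ^ (a - 1) * f t) := by
    ext t
    simp only [ContinuousLinearMap.mul_apply', RLKernel, indicator_apply, mem_Ioi, mem_Ioo,
      sub_pos]
    split_ifs <;> first | tauto | ring
  rw [ConvolutionExistsAt, heq, integrable_indicator_iff measurableSet_Ioo]
  rcases le_or_gt x 0 with hx | hx
  · simp [Ioo_eq_empty_of_le hx]
  · exact (((hf.intervalIntegrable_kernel_mul ha hx).const_mul _).1).mono_set Ioo_subset_Ioc_self

theorem norm_RLKernel {a : ℝ} (ha : 0 < a) (t : ℝ) : ‖RLKernel a t‖ = RLKernel a t :=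
  norm_of_nonneg (indicator_nonneg (fun _ hs =>
    div_nonneg (rpow_nonneg (le_of_lt hs) _) (Gamma_pos_of_pos ha).le) t)

theorem spaceC_rpow_sub_one_div_Gamma {a : ℝ} (ha : 0 < a) :
    SpaceC (-1) fun t => t ^ (a - 1) / Gamma a := by
  simpa only [div_eq_inv_mul] using (spaceC_rpow (show -1 < a - 1 by linarith)).const_mul
    (Gamma a)⁻¹

theorem RLKernel_convolution_RLKernel {a b : ℝ} (ha : 0 < a) (hb : 0 < b) :
    convolution (RLKernel b) (RLKernel a) (ContinuousLinearMap.mul ℝ ℝ) volume =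
      RLKernel (a + b) := by
  rw [RLKernel, ← indicator_RL_eq_convolution ha, RLKernel]
  refine indicator_congr fun x hx => ?_
  have h := RL_rpow_div_Gamma ha.le (show -1 < b - 1 by linarith) hx
  simp only [sub_add_cancel] at h
  rw [h]
  congr 2 <;> ring

theorem SpaceC.aestronglyMeasurable_indicator {γ : ℝ} {f : ℝ → ℝ} (hf : SpaceC γ f) :
    AEStronglyMeasurable ((Ioi 0).indicator f) volume :=
  (aestronglyMeasurable_indicator_iff measurableSet_Ioi).2
    (hf.continuousOn.aestronglyMeasurable measurableSet_Ioi)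

/-- The semigroup property of the Riemann–Liouville integral. -/
theorem RL_RL {f : ℝ → ℝ} (hf : SpaceC (-1) f) {a b x : ℝ} (ha : 0 ≤ a) (hb : 0 ≤ b)
    (hx : 0 < x) : RL a (RL b f) x = RL (a + b) f x := by
  rcases ha.eq_or_lt with rfl | ha
  · rw [RL_zero, zero_add]
  rcases hb.eq_or_lt with rfl | hb
  · rw [RL_zero, add_zero]
  have hmem : x ∈ Ioi (0 : ℝ) := hx
  rw [← indicator_of_mem hmem (RL a (RL b f)), ← indicator_of_mem hmem (RL (a + b) f),
    indicator_RL_eq_convolution ha, indicator_RL_eq_convolution hb,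
    indicator_RL_eq_convolution (add_pos ha hb), ← RLKernel_convolution_RLKernel ha hb]
  have hKb := spaceC_rpow_sub_one_div_Gamma hb
  refine convolution_assoc _ _ _ _ (fun u v w => mul_assoc u v w)
    hf.aestronglyMeasurable_indicator hKb.aestronglyMeasurable_indicator
    (spaceC_rpow_sub_one_div_Gamma ha).aestronglyMeasurable_indicator
    (Eventually.of_forall fun t => hf.convolutionExistsAt hb t)
    (Eventually.of_forall fun t => ?_) ?_
  · simp only [norm_RLKernel ha, norm_RLKernel hb]
    exact hKb.convolutionExistsAt ha t
  · simp only [norm_RLKernel ha, norm_RLKernel hb, norm_indicator_eq_indicator_norm]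
    rw [RLKernel_convolution_RLKernel ha hb]
    exact hf.abs.convolutionExistsAt (add_pos ha hb) x

theorem hasDerivAt_RL_one {f : ℝ → ℝ} (hf : SpaceC (-1) f) {x : ℝ} (hx : 0 < x) :
    HasDerivAt (RL 1 f) (f x) x := by
  rw [show RL 1 f = fun u => ∫ t in (0 : ℝ)..u, f t from funext (RL_one f)]
  exact intervalIntegral.integral_hasDerivAt_right (hf.intervalIntegrable hx)
    (hf.continuousOn.stronglyMeasurableAtFilter isOpen_Ioi x hx)
    (hf.continuousOn.continuousAt (Ioi_mem_nhds hx))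

theorem eq_of_RL_eq {f g : ℝ → ℝ} (hf : SpaceC (-1) f) (hg : SpaceC (-1) g) {a : ℝ} (ha : 0 ≤ a)
    (ha1 : a ≤ 1) (h : ∀ x > 0, RL a f x = RL a g x) {x : ℝ} (hx : 0 < x) : f x = g x := by
  have h1 : ∀ u > 0, RL 1 f u = RL 1 g u := fun u hu => by
    have := RL_congr h (1 - a) hu
    rwa [RL_RL hf (sub_nonneg.2 ha1) ha hu, RL_RL hg (sub_nonneg.2 ha1) ha hu,
      sub_add_cancel] at this
  refine (hasDerivAt_RL_one hf hx).unique ((hasDerivAt_RL_one hg hx).congr_of_eventuallyEq ?_)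
  filter_upwards [Ioi_mem_nhds hx] with u hu using h1 u hu

/-- Taylor's formula on `(0, ∞)` at `0+`, with remainder a Riemann–Liouville integral. -/
theorem eq_sum_add_RL_iteratedDerivWithin {n : ℕ} {g : ℝ → ℝ} (hg : SpaceCm n (-1) g) {c : ℕ → ℝ}
    (hc : ∀ k < n, Tendsto (iteratedDerivWithin k g (Ioi 0)) (𝓝[>] 0) (𝓝 (c k))) {x : ℝ}
    (hx : 0 < x) :
    g x = (∑ k ∈ Finset.range n, x ^ (k : ℝ) / Gamma ((k : ℝ) + 1) * c k) +
      RL n (iteratedDerivWithin n g (Ioi 0)) x := by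
  induction n with
  | zero => simp [RL]
  | succ n ih =>
    obtain ⟨hdiff, hC⟩ := hg
    have hFTC : ∀ u > 0, iteratedDerivWithin n g (Ioi 0) u =
        c n * (u ^ (0 : ℝ) / Gamma (0 + 1)) +
          RL 1 (iteratedDerivWithin (n + 1) g (Ioi 0)) u := fun u hu => by
      have hderiv : ∀ v ∈ Ioi (0 : ℝ), HasDerivAt (iteratedDerivWithin n g (Ioi 0))
          (iteratedDerivWithin (n + 1) g (Ioi 0) v) v := fun v hv => by
        rw [iteratedDerivWithin_succ]
        exact ((hdiff n n.lt_succ_self v hv).hasDerivWithinAt).hasDerivAt (Ioi_mem_nhds hv)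
      rw [RL_one, intervalIntegral.integral_eq_sub_of_hasDerivAt_of_tendsto hu
        (fun v hv => hderiv v hv.1) (hC.intervalIntegrable hu) (hc n n.lt_succ_self)
        ((hderiv u hu).continuousAt.tendsto.mono_left nhdsWithin_le_nhds)]
      simp
    have hconst : SpaceC (-1) fun u : ℝ => c n * (u ^ (0 : ℝ) / Gamma (0 + 1)) := by
      simpa using (spaceC_rpow (show (-1 : ℝ) < 0 by norm_num)).const_mul (c n)
    have hR := hC.RL zero_le_one
    rw [ih ⟨fun k hk => hdiff k (by omega), (hconst.add hR).congr hFTC⟩ fun k hk =>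
      hc k (by omega), RL_congr hFTC n hx, RL_add hconst hR n.cast_nonneg hx,
      RL_const_mul, RL_rpow_div_Gamma n.cast_nonneg (by norm_num) hx,
      RL_RL hC n.cast_nonneg zero_le_one hx, Finset.sum_range_succ, add_zero, Nat.cast_succ]
    ring

/-- for `y ∈ Ω^α_β` (with `n - 1 < α ≤ n`, `0 ≤ β ≤ 1`),
`(I^α D^{α,β} y)(x) = y(x) - Σ_{k<n} x^{k-n+α-βα+βn}/Γ(k-n+α-βα+βn+1) ·
(I^{(1-β)(n-α)} y)^{(k)}(0+)`. -/
theorem rl_integral_hilferD (n : ℕ) (hn1 : 1 ≤ n) (α β : ℝ)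
    (hαl : (n : ℝ) - 1 < α) (hαu : α ≤ n) (hβ0 : 0 ≤ β) (hβ1 : β ≤ 1)
    (y : ℝ → ℝ) (hy : OmegaSpace n α β y)
    (c : ℕ → ℝ)
    (hc : ∀ k < n,
      Tendsto (iteratedDerivWithin k (RL ((1 - β) * (n - α)) y) (Set.Ioi 0))
        (𝓝[>] (0:ℝ)) (𝓝 (c k))) :
    ∀ x > 0, RL α (hilferD n α β y) x =
      y x - ∑ k ∈ Finset.range n,
        x ^ ((k : ℝ) - n + α - β * α + β * n) /
          Real.Gamma ((k : ℝ) - n + α - β * α + β * n + 1) * c k := by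
  intro x hx
  obtain ⟨hyC, hg⟩ := hy
  have hα0 : 0 < α := by
    have : (1 : ℝ) ≤ n := by exact_mod_cast hn1
    linarith
  have hb0 : 0 ≤ β * (n - α) := mul_nonneg hβ0 (by linarith)
  have hd0 : 0 ≤ (1 - β) * (n - α) := mul_nonneg (by linarith) (by linarith)
  have hd1 : (1 - β) * (n - α) < 1 := by nlinarith
  have hexp : ∀ k : ℕ, (k : ℝ) - n + α - β * α + β * n = k - (1 - β) * (n - α) := fun k => by ring
  have hC := hg.2
  simp only [hexp]
  rw [hilferD, RL_RL hC hα0.le hb0 hx]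
  rw [show α + β * (n - α) = n - (1 - β) * (n - α) by ring]
  set d := (1 - β) * (n - α)
  have hnd : 0 ≤ n - d := by linarith
  have hterm : ∀ k < n, SpaceC (-1) fun t : ℝ => t ^ ((k : ℝ) - d) / Gamma (k - d + 1) * c k :=
    fun k _ => by
      have hk : (-1 : ℝ) < k - d := by linarith [k.cast_nonneg (α := ℝ)]
      exact ((spaceC_rpow hk).const_mul ((Gamma (k - d + 1))⁻¹ * c k)).congr fun t _ => by ring
  have hsum := spaceC_sum n hterm
  rw [eq_sub_iff_add_eq']
  refine eq_of_RL_eq (hsum.add (hC.RL hnd)) hyC hd0 hd1.le (fun u hu => ?_) hx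
  rw [RL_add hsum (hC.RL hnd) hd0 hu, RL_sum n hterm hd0 hu, RL_RL hC hd0 hnd hu,
    eq_sum_add_RL_iteratedDerivWithin hg hc hu, add_sub_cancel]
  congr 1
  refine Finset.sum_congr rfl fun k _ => ?_
  have hk : (-1 : ℝ) < k - d := by linarith [k.cast_nonneg (α := ℝ)]
  simp_rw [mul_comm _ (c k)]
  rw [RL_const_mul, RL_rpow_div_Gamma hd0 hk hu, add_sub_cancel]
end

section
/- The ring (C_{−1}, ⋆, +) has no divisors of zero: if f, g ∈ C_{−1} and (f ⋆ g)(x) = 0 for all x > 0, then f is identically zero on (0,∞) or g is identically zero on (0,∞). -/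
open Real MeasureTheory Filter Set Topology

theorem laplaceConv_congr_s5 {f f' g g' : ℝ → ℝ} {x : ℝ} (hx : 0 < x)
    (hf : EqOn f f' (Ioo 0 x)) (hg : EqOn g g' (Ioo 0 x)) :
    laplaceConv f g x = laplaceConv f' g' x := by
  refine intervalIntegral.integral_congr_Ioo_of_le hx.le fun t ht => ?_
  rw [hf ⟨by linarith [ht.2], by linarith [ht.1]⟩, hg ht]

theorem laplaceConv_comm (f g : ℝ → ℝ) (x : ℝ) : laplaceConv f g x = laplaceConv g f x := by
  have h := intervalIntegral.integral_comp_sub_left (a := 0) (b := x)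
    (fun t => f t * g (x - t)) x
  simp only [sub_self, sub_zero, sub_sub_cancel] at h
  simp only [laplaceConv, h]
  simp only [mul_comm]

theorem laplaceConv_zero_left (g : ℝ → ℝ) (x : ℝ) : laplaceConv (fun _ => 0) g x = 0 := by
  simp [laplaceConv]

theorem laplaceConv_continuous {f g : ℝ → ℝ} (hf : Continuous f) (hg : Continuous g) :
    Continuous (laplaceConv f g) := by
  unfold laplaceConv
  exact intervalIntegral.continuous_parametric_intervalIntegral_of_continuous
    (by fun_prop) continuous_id

/-- The Laplace convolution is the convolution on `ℝ` of functions that vanish on `(-∞, 0]`. -/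
theorem convolution_eq_laplaceConv {A C f g : ℝ → ℝ} {x : ℝ} (hx : 0 < x)
    (hA : ∀ t ≤ 0, A t = 0) (hC : ∀ t ≤ 0, C t = 0)
    (hf : EqOn A f (Ioo 0 x)) (hg : EqOn C g (Ioo 0 x)) :
    convolution A C (ContinuousLinearMap.mul ℝ ℝ) volume x = laplaceConv f g x := by
  have key : ∀ B : ℝ → ℝ, (∀ t ≤ 0, B t = 0) → indicator (Ioi 0) B = B := fun B hB => by
    rw [indicator_eq_self]
    intro t ht
    by_contra h
    exact ht (hB t (not_lt.1 h))
  have h := congrFun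
    (posConvolution_eq_convolution_indicator A C (ContinuousLinearMap.mul ℝ ℝ) volume) x
  rw [key A hA, key C hC] at h
  rw [← h, posConvolution, indicator_of_mem (mem_Ioi.2 hx), laplaceConv_comm,
    ← laplaceConv_congr_s5 hx hg hf]
  simp [laplaceConv, mul_comm]

theorem convolution_eq_zero_of_nonpos {A C : ℝ → ℝ}
    (hA : ∀ t ≤ 0, A t = 0) (hC : ∀ t ≤ 0, C t = 0) {x : ℝ} (hx : x ≤ 0) :
    convolution A C (ContinuousLinearMap.mul ℝ ℝ) volume x = 0 := by
  refine integral_eq_zero_of_ae (Eventually.of_forall fun t => ?_)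
  rcases le_or_gt t 0 with h | h
  · simp [hA t h]
  · simp [hC (x - t) (by linarith)]

theorem laplaceConv_assoc {f g h : ℝ → ℝ} {x : ℝ} (hx : 0 < x)
    (hf : IntervalIntegrable f volume 0 x) (hg : IntervalIntegrable g volume 0 x)
    (hh : Continuous h) :
    laplaceConv (laplaceConv f g) h x = laplaceConv f (laplaceConv g h) x := by
  set a := indicator (Ioo 0 x) f with ha
  set b := indicator (Ioo 0 x) g with hb
  set c := indicator (Ioo 0 x) h with hc
  have van : ∀ F : ℝ → ℝ, ∀ t ≤ 0, indicator (Ioo 0 x) F t = 0 := fun F t ht =>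
    indicator_of_notMem (fun h => absurd h.1 (not_lt.2 ht)) _
  have eqI : ∀ F : ℝ → ℝ, ∀ y ≤ x, EqOn (indicator (Ioo 0 x) F) F (Ioo 0 y) := fun F y hy t ht =>
    indicator_of_mem (Ioo_subset_Ioo_right hy ht) _
  have int : ∀ F : ℝ → ℝ, IntervalIntegrable F volume 0 x →
      Integrable (indicator (Ioo 0 x) F) := fun F hF => by
    rw [integrable_indicator_iff measurableSet_Ioo]
    exact ((intervalIntegrable_iff_integrableOn_Ioc_of_le hx.le).1 hF).mono_set Ioo_subset_Ioc_self
  have ia := int f hf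
  have ib := int g hg
  have ic := int h (hh.intervalIntegrable _ _)
  have hab : EqOn (convolution a b (ContinuousLinearMap.mul ℝ ℝ) volume) (laplaceConv f g)
      (Ioo 0 x) := fun y hy =>
    convolution_eq_laplaceConv hy.1 (van f) (van g) (eqI f y hy.2.le) (eqI g y hy.2.le)
  have hbc : EqOn (convolution b c (ContinuousLinearMap.mul ℝ ℝ) volume) (laplaceConv g h)
      (Ioo 0 x) := fun y hy =>
    convolution_eq_laplaceConv hy.1 (van g) (van h) (eqI g y hy.2.le) (eqI h y hy.2.le)
  rw [← convolution_eq_laplaceConv hx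
      (fun t ht => convolution_eq_zero_of_nonpos (van f) (van g) ht) (van h) hab (eqI h x le_rfl),
    ← convolution_eq_laplaceConv hx (van f)
      (fun t ht => convolution_eq_zero_of_nonpos (van g) (van h) ht) (eqI f x le_rfl) hbc]
  obtain ⟨M, hM⟩ := isCompact_Icc.exists_bound_of_continuousOn (s := Icc 0 x) hh.continuousOn
  have hM0 : 0 ≤ M := (norm_nonneg _).trans (hM 0 ⟨le_rfl, hx.le⟩)
  have hcM : ∀ t, ‖c t‖ ≤ M := fun t => by
    by_cases ht : t ∈ Ioo 0 x
    · rw [hc, indicator_of_mem ht]; exact hM t (Ioo_subset_Icc_self ht)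
    · rw [hc, indicator_of_notMem ht]; simpa using hM0
  refine convolution_assoc _ _ _ _ (fun x y z => by simp [mul_assoc]) ia.1 ib.1 ic.1
    (ia.ae_convolution_exists _ ib) (ib.norm.ae_convolution_exists _ ic.norm) ?_
  refine BddAbove.convolutionExistsAt _ (s := univ) ?_ MeasurableSet.univ (subset_univ _)
    ia.norm.integrableOn (ib.norm.integrable_convolution _ ic.norm).1
  refine ⟨∫ t, ‖b t‖ * M, ?_⟩
  rintro _ ⟨y, -, rfl⟩
  refine norm_integral_le_of_norm_le (ib.norm.mul_const M) (Eventually.of_forall fun t => ?_)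
  simp only [ContinuousLinearMap.mul_apply', norm_mul, norm_norm]
  gcongr
  exact hcM _

theorem hasSum_pow_div_factorial_exp (x : ℝ) :
    HasSum (fun k : ℕ => x ^ k / (k.factorial : ℝ)) (exp x) := by
  rw [Real.exp_eq_exp_ℝ]
  exact NormedSpace.expSeries_div_hasSum_exp _

/-- A function on `[0, T]` with bounded exponential moments vanishes. -/
theorem eq_zero_of_bounded_exp_moments {f : ℝ → ℝ} (hf : Continuous f) {T M : ℝ}
    (hM : ∀ n : ℕ, |∫ t in (0:ℝ)..T, exp (n * t) * f t| ≤ M) :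
    ∀ t ∈ Ioo 0 T, f t = 0 := by
  have primitive_const : ∀ a ∈ Ioo 0 T, ∫ t in (0:ℝ)..a, f t = ∫ t in (0:ℝ)..T, f t := by
    intro a ha
    have hT : 0 < T := ha.1.trans ha.2
    have bound : ∀ n : ℕ, ‖(∫ t in (0:ℝ)..T, exp (-exp (n * (t - a))) * f t) -
        ∫ t in (0:ℝ)..T, f t‖ ≤ M * (exp (exp (n * -a)) - 1) := by
      intro n
      have h1 : HasSum (fun k : ℕ => ∫ t in (0:ℝ)..T,
          ((-exp (n * (t - a))) ^ k / k.factorial) * f t)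
          (∫ t in (0:ℝ)..T, exp (-exp (n * (t - a))) * f t) := by
        refine intervalIntegral.hasSum_integral_of_dominated_convergence
          (fun k t => ((exp (n * T)) ^ k / k.factorial) * ‖f t‖) ?_ ?_ ?_ ?_ ?_
        · intro k
          exact Continuous.aestronglyMeasurable (by fun_prop)
        · refine fun k => Eventually.of_forall fun t ht => ?_
          rw [uIoc_of_le hT.le] at ht
          rw [norm_mul, norm_div, norm_pow, norm_neg, Real.norm_natCast,
            Real.norm_of_nonneg (exp_pos _).le]
          gcongr
          linarith [ht.2, ha.1]
        · exact Eventually.of_forall fun t _ =>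
            (Real.summable_pow_div_factorial _).mul_right _
        · simp_rw [tsum_mul_right]
          exact Continuous.intervalIntegrable (by fun_prop) _ _
        · exact Eventually.of_forall fun t _ => (hasSum_pow_div_factorial_exp _).mul_right _
      have h2 : HasSum (fun k : ℕ => M * (exp (n * -a) ^ k / k.factorial))
          (M * exp (exp (n * -a))) := (hasSum_pow_div_factorial_exp _).mul_left _
      have h1' := (hasSum_nat_add_iff' 1).2 h1
      have h2' := (hasSum_nat_add_iff' 1).2 h2
      simp only [Finset.range_one, Finset.sum_singleton, pow_zero, Nat.factorial_zero, Nat.cast_one,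
        div_one, one_mul, mul_one] at h1' h2'
      rw [mul_sub, mul_one]
      refine h1'.norm_le_of_bounded h2' fun k => ?_
      have e : ∀ t, ((-exp (n * (t - a))) ^ (k + 1) / ((k + 1).factorial : ℝ)) * f t =
          ((-1) ^ (k + 1) * exp (n * -a) ^ (k + 1) / ((k + 1).factorial : ℝ)) *
            (exp ((n * (k + 1) : ℕ) * t) * f t) := fun t => by
        rw [neg_pow, mul_sub, sub_eq_add_neg, exp_add, mul_pow, ← exp_nat_mul (n * t)]
        push_cast
        ring_nf
      simp_rw [e]
      rw [intervalIntegral.integral_const_mul, norm_mul, norm_div, norm_mul, norm_pow, norm_pow,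
        Real.norm_natCast, norm_neg, norm_one, one_pow, one_mul,
        Real.norm_of_nonneg (exp_pos _).le, mul_comm]
      gcongr
      exact hM _
    have lim0 : Tendsto (fun n : ℕ => exp (n * -a)) atTop (𝓝 0) := by
      refine Real.tendsto_exp_atBot.comp ?_
      exact tendsto_natCast_atTop_atTop.atTop_mul_const_of_neg (by linarith [ha.1])
    have lim1 : Tendsto (fun n : ℕ => M * (exp (exp (n * -a)) - 1)) atTop (𝓝 0) := by
      have := ((Real.continuous_exp.tendsto 0).comp lim0).sub_const 1 |>.const_mul M
      simpa using this
    have lim2 : Tendsto (fun n : ℕ => ∫ t in (0:ℝ)..T, exp (-exp (n * (t - a))) * f t) atTop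
        (𝓝 (∫ t in (0:ℝ)..T, indicator {t | t ≤ a} f t)) := by
      refine intervalIntegral.tendsto_integral_filter_of_dominated_convergence (fun t => ‖f t‖)
        (Eventually.of_forall fun n => Continuous.aestronglyMeasurable (by fun_prop))
        (Eventually.of_forall fun n => Eventually.of_forall fun t _ => ?_)
        (hf.norm.intervalIntegrable _ _) ?_
      · rw [norm_mul, Real.norm_of_nonneg (exp_pos _).le]
        refine mul_le_of_le_one_left (norm_nonneg _) (exp_le_one_iff.2 ?_)
        linarith [exp_pos (n * (t - a))]
      · filter_upwards [compl_mem_ae_iff.2 (measure_singleton a)] with t hta _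
        rcases lt_or_gt_of_ne (show t ≠ a from hta) with h | h
        · rw [indicator_of_mem (show t ∈ {t | t ≤ a} from h.le)]
          have l : Tendsto (fun n : ℕ => exp (n * (t - a))) atTop (𝓝 0) :=
            Real.tendsto_exp_atBot.comp
              (tendsto_natCast_atTop_atTop.atTop_mul_const_of_neg (by linarith))
          simpa using ((Real.continuous_exp.tendsto _).comp l.neg).mul_const (f t)
        · rw [indicator_of_notMem (show t ∉ {t | t ≤ a} from not_le.2 h)]
          have l : Tendsto (fun n : ℕ => exp (n * (t - a))) atTop atTop :=
            Real.tendsto_exp_atTop.comp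
              (tendsto_natCast_atTop_atTop.atTop_mul_const (by linarith))
          simpa using (Real.tendsto_exp_atBot.comp
            (tendsto_neg_atTop_atBot.comp l)).mul_const (f t)
    rw [intervalIntegral.integral_indicator ⟨ha.1.le, ha.2.le⟩] at lim2
    have lim3 := squeeze_zero_norm bound lim1
    exact tendsto_nhds_unique lim2 (by simpa using lim3.add_const (∫ t in (0:ℝ)..T, f t))
  intro t ht
  have d1 : HasDerivAt (fun a => ∫ t in (0:ℝ)..a, f t) (f t) t :=
    intervalIntegral.integral_hasDerivAt_right (hf.intervalIntegrable _ _)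
      hf.stronglyMeasurable.stronglyMeasurableAtFilter hf.continuousAt
  refine d1.unique ((hasDerivAt_const t (∫ t in (0:ℝ)..T, f t)).congr_of_eventuallyEq ?_)
  filter_upwards [Ioo_mem_nhds ht.1 ht.2] with a ha using primitive_const a ha

theorem intervalIntegral_sq_le_of_laplaceConv_self_eq_zero {f : ℝ → ℝ} (hf : Continuous f)
    (hff : ∀ x > 0, laplaceConv f f x = 0) {S A c : ℝ} (hS : 0 < S) (hc : 0 ≤ c)
    (hA : ∀ t ∈ Icc 0 S, |f t| ≤ A) :
    (∫ u in (0:ℝ)..S, exp (-(c * u)) * f u) ^ 2 ≤ (A * S) ^ 2 * exp (-(c * S)) := by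
  set h : ℝ → ℝ := fun u => exp (-(c * u)) * f u with hh
  have hcont : Continuous h := by fun_prop
  have hhh : ∀ x > 0, laplaceConv h h x = 0 := fun x hx => by
    have : laplaceConv h h x = exp (-(c * x)) * laplaceConv f f x := by
      simp only [laplaceConv, hh, ← intervalIntegral.integral_const_mul]
      congr 1 with t
      rw [show -(c * x) = -(c * (x - t)) + -(c * t) by ring, exp_add]
      ring
    rw [this, hff x hx, mul_zero]
  have hA0 : 0 ≤ A := (abs_nonneg _).trans (hA 0 ⟨le_rfl, hS.le⟩)
  have hint : ∀ a b, IntervalIntegrable h volume a b := fun a b => hcont.intervalIntegrable a b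
  have hzero : ∫ u in (0:ℝ)..S, (∫ v in (0:ℝ)..(S - u), h v) * h u = 0 := by
    have := laplaceConv_assoc hS (f := fun _ => 1) (g := h) (h := h)
      intervalIntegrable_const (hint _ _) hcont
    rw [laplaceConv_comm (fun _ => 1) (laplaceConv h h),
      laplaceConv_congr_s5 hS (f' := fun _ => 0) (fun t ht => hhh t ht.1) (fun _ _ => rfl),
      laplaceConv_zero_left] at this
    simpa only [laplaceConv, one_mul] using this
  have hsq : (∫ u in (0:ℝ)..S, h u) ^ 2 =
      ∫ u in (0:ℝ)..S, (∫ v in (S - u)..S, h v) * h u := by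
    have hp : Continuous fun u => ∫ v in (0:ℝ)..(S - u), h v :=
      (intervalIntegral.continuous_primitive hint 0).comp (by fun_prop)
    have : ∀ u, (∫ v in (S - u)..S, h v) * h u =
        (∫ v in (0:ℝ)..S, h v) * h u - (∫ v in (0:ℝ)..(S - u), h v) * h u := fun u => by
      rw [← sub_mul, intervalIntegral.integral_interval_sub_left (hint _ _) (hint _ _)]
    simp_rw [this]
    rw [intervalIntegral.integral_sub ((hint _ _).const_mul _)
      (Continuous.intervalIntegrable (by fun_prop) _ _), hzero, intervalIntegral.integral_const_mul]
    ring
  have hb : ∀ t ∈ Icc 0 S, ∀ s ≤ t, |h t| ≤ A * exp (-(c * s)) := fun t ht s hs => by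
    rw [hh, abs_mul, abs_of_pos (exp_pos _), mul_comm]
    gcongr
    exact hA t ht
  rw [hsq]
  refine (le_abs_self _).trans ?_
  have key : ∀ u ∈ uIoc 0 S, ‖(∫ v in (S - u)..S, h v) * h u‖ ≤ A ^ 2 * S * exp (-(c * S)) := by
    intro u hu
    rw [uIoc_of_le hS.le] at hu
    have h1 : ‖∫ v in (S - u)..S, h v‖ ≤ A * exp (-(c * (S - u))) * |S - (S - u)| := by
      refine intervalIntegral.norm_integral_le_of_norm_le_const fun v hv => ?_
      rw [uIoc_of_le (by linarith [hu.1])] at hv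
      exact hb v ⟨by linarith [hv.1, hu.2], hv.2⟩ _ hv.1.le
    rw [sub_sub_cancel, abs_of_pos hu.1] at h1
    have h2 := hb u ⟨hu.1.le, hu.2⟩ u le_rfl
    rw [norm_mul]
    calc _ ≤ (A * exp (-(c * (S - u))) * S) * (A * exp (-(c * u))) := by
            refine mul_le_mul (h1.trans ?_) h2 (norm_nonneg _) (by positivity)
            gcongr
            exact hu.2
      _ = A ^ 2 * S * (exp (-(c * (S - u))) * exp (-(c * u))) := by ring
      _ = _ := by rw [← exp_add]; ring_nf
  have := intervalIntegral.norm_integral_le_of_norm_le_const key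
  rw [sub_zero, abs_of_pos hS, norm_eq_abs] at this
  refine this.trans (le_of_eq ?_)
  ring

theorem eq_zero_of_laplaceConv_self_eq_zero {f : ℝ → ℝ} (hf : Continuous f)
    (hff : ∀ x > 0, laplaceConv f f x = 0) : ∀ x > 0, f x = 0 := by
  intro x hx
  obtain ⟨T, rfl⟩ : ∃ T, x = T / 2 := ⟨2 * x, by ring⟩
  have hT : 0 < T := by linarith
  obtain ⟨A, hA⟩ := isCompact_Icc.exists_bound_of_continuousOn (s := Icc 0 (2 * T)) hf.continuousOn
  have hA0 : 0 ≤ A := (norm_nonneg _).trans (hA 0 ⟨le_rfl, by linarith⟩)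
  have moments : ∀ n : ℕ, |∫ t in (0:ℝ)..T, exp (n * t) * f (T - t)| ≤
      A * (2 * T) + A * T := by
    intro n
    set h : ℝ → ℝ := fun u => exp (-(n * u)) * f u with hh
    have hcont : Continuous h := by fun_prop
    have hsub : ∫ t in (0:ℝ)..T, exp (n * t) * f (T - t) =
        exp (n * T) * ∫ u in (0:ℝ)..T, h u := by
      have := intervalIntegral.integral_comp_sub_left (a := 0) (b := T)
        (fun t => exp (n * (T - t)) * f t) T
      simp only [sub_self, sub_zero, sub_sub_cancel] at this
      rw [this, ← intervalIntegral.integral_const_mul]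
      congr 1 with u
      rw [hh, ← mul_assoc, ← exp_add]
      ring_nf
    have hsplit : ∫ u in (0:ℝ)..T, h u = (∫ u in (0:ℝ)..(2 * T), h u) - ∫ u in T..(2 * T), h u := by
      rw [eq_sub_iff_add_eq, intervalIntegral.integral_add_adjacent_intervals
        (hcont.intervalIntegrable _ _) (hcont.intervalIntegrable _ _)]
    have h1 : |∫ u in (0:ℝ)..(2 * T), h u| ≤ A * (2 * T) * exp (-(n * T)) := by
      refine abs_le_of_sq_le_sq ?_ (by positivity)
      refine (intervalIntegral_sq_le_of_laplaceConv_self_eq_zero hf hff (by linarith)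
        n.cast_nonneg hA).trans (le_of_eq ?_)
      rw [mul_pow _ (exp _), ← exp_nat_mul]
      push_cast
      ring_nf
    have h2 : |∫ u in T..(2 * T), h u| ≤ A * T * exp (-(n * T)) := by
      have : ∀ u ∈ uIoc T (2 * T), ‖h u‖ ≤ A * exp (-(n * T)) := fun u hu => by
        rw [uIoc_of_le (by linarith)] at hu
        rw [hh, norm_mul, norm_of_nonneg (exp_pos _).le, mul_comm]
        gcongr
        · exact hA u ⟨by linarith [hu.1], hu.2⟩
        · exact hu.1.le
      have := intervalIntegral.norm_integral_le_of_norm_le_const this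
      rw [show 2 * T - T = T by ring, abs_of_pos hT, norm_eq_abs] at this
      exact this.trans (le_of_eq (by ring))
    rw [hsub, hsplit, abs_mul, abs_of_pos (exp_pos _)]
    calc _ ≤ exp (n * T) * (A * (2 * T) * exp (-(n * T)) + A * T * exp (-(n * T))) := by
            gcongr
            exact (abs_sub _ _).trans (add_le_add h1 h2)
      _ = (A * (2 * T) + A * T) * (exp (n * T) * exp (-(n * T))) := by ring
      _ = _ := by rw [← exp_add, add_neg_cancel, exp_zero, mul_one]
  have := eq_zero_of_bounded_exp_moments (f := fun t => f (T - t)) (by fun_prop) moments (T / 2)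
    ⟨by linarith, by linarith⟩
  simpa [show T - T / 2 = T / 2 by ring] using this

theorem laplaceConv_id_mul_eq_zero {f g : ℝ → ℝ} (hf : Continuous f) (hg : Continuous g)
    (hfg : ∀ x > 0, laplaceConv f g x = 0) :
    ∀ x > 0, laplaceConv f (fun t => t * g t) x = 0 := by
  set f₁ : ℝ → ℝ := fun t => t * f t with hf₁
  set g₁ : ℝ → ℝ := fun t => t * g t with hg₁
  have cf₁ : Continuous f₁ := by fun_prop
  have cg₁ : Continuous g₁ := by fun_prop
  have ii : ∀ {F : ℝ → ℝ}, Continuous F → ∀ x, IntervalIntegrable F volume 0 x :=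
    fun hF x => hF.intervalIntegrable _ _
  have leibniz : ∀ x > 0, laplaceConv f g₁ x = - laplaceConv f₁ g x := fun x hx => by
    have : laplaceConv f g₁ x + laplaceConv f₁ g x = x * laplaceConv f g x := by
      simp only [laplaceConv, hf₁, hg₁]
      rw [← intervalIntegral.integral_add (Continuous.intervalIntegrable (by fun_prop) _ _)
        (Continuous.intervalIntegrable (by fun_prop) _ _), ← intervalIntegral.integral_const_mul]
      congr 1 with t
      ring
    rw [hfg x hx, mul_zero] at this
    linarith
  have cK : Continuous (laplaceConv g₁ f₁) := laplaceConv_continuous cg₁ cf₁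
  have cL : Continuous (laplaceConv f₁ g) := laplaceConv_continuous cf₁ hg
  refine eq_zero_of_laplaceConv_self_eq_zero (laplaceConv_continuous hf cg₁) fun x hx => ?_
  calc laplaceConv (laplaceConv f g₁) (laplaceConv f g₁) x
      = laplaceConv (laplaceConv f g₁) (fun t => - laplaceConv f₁ g t) x :=
        laplaceConv_congr_s5 hx (fun _ _ => rfl) fun t ht => leibniz t ht.1
    _ = - laplaceConv (laplaceConv f g₁) (laplaceConv f₁ g) x := by
        simp [laplaceConv]
    _ = - laplaceConv f (laplaceConv g₁ (laplaceConv f₁ g)) x := by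
        rw [laplaceConv_assoc hx (ii hf x) (ii cg₁ x) cL]
    _ = - laplaceConv f (laplaceConv g (laplaceConv g₁ f₁)) x := by
        rw [laplaceConv_congr_s5 hx (fun _ _ => rfl) fun t ht => ?_]
        rw [laplaceConv_comm g, laplaceConv_assoc ht.1 (ii cg₁ t) (ii cf₁ t) hg]
    _ = - laplaceConv (laplaceConv f g) (laplaceConv g₁ f₁) x := by
        rw [laplaceConv_assoc hx (ii hf x) (ii hg x) cK]
    _ = 0 := by
        rw [laplaceConv_congr_s5 hx (f' := fun _ => 0) (fun t ht => hfg t ht.1) (fun _ _ => rfl),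
          laplaceConv_zero_left, neg_zero]

theorem eqOn_zero_of_polynomial_moments {φ : ℝ → ℝ} (hφ : Continuous φ) {T : ℝ} (hT : 0 < T)
    (hm : ∀ n : ℕ, ∫ t in (0:ℝ)..T, t ^ n * φ t = 0) : ∀ t ∈ Ioo 0 T, φ t = 0 := by
  refine eq_zero_of_bounded_exp_moments hφ (M := 0) fun n => ?_
  have hs : HasSum (fun k : ℕ => ∫ t in (0:ℝ)..T, ((n * t) ^ k / k.factorial) * φ t)
      (∫ t in (0:ℝ)..T, exp (n * t) * φ t) := by
    refine intervalIntegral.hasSum_integral_of_dominated_convergence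
      (fun k t => ((n * T) ^ k / k.factorial) * ‖φ t‖)
      (fun k => Continuous.aestronglyMeasurable (by fun_prop))
      (fun k => Eventually.of_forall fun t ht => ?_)
      (Eventually.of_forall fun t _ => (Real.summable_pow_div_factorial _).mul_right _) ?_
      (Eventually.of_forall fun t _ => (hasSum_pow_div_factorial_exp _).mul_right _)
    · rw [uIoc_of_le hT.le] at ht
      have := ht.1.le
      rw [norm_mul, norm_of_nonneg (by positivity)]
      gcongr
      exact ht.2
    · simp_rw [tsum_mul_right]
      exact Continuous.intervalIntegrable (by fun_prop) _ _
  have hz : ∀ k : ℕ, ∫ t in (0:ℝ)..T, ((n * t) ^ k / k.factorial) * φ t = 0 := fun k => by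
    have : ∀ t, ((n * t) ^ k / k.factorial) * φ t =
        ((n : ℝ) ^ k / k.factorial) * (t ^ k * φ t) := fun t => by ring
    simp_rw [this]
    rw [intervalIntegral.integral_const_mul, hm, mul_zero]
  simp_rw [hz] at hs
  rw [hs.unique hasSum_zero, abs_zero]

/-- Titchmarsh's theorem on `(0, ∞)` for continuous functions. -/
theorem eq_zero_or_eq_zero_of_laplaceConv_eq_zero {f g : ℝ → ℝ} (hf : Continuous f)
    (hg : Continuous g) (hfg : ∀ x > 0, laplaceConv f g x = 0) :
    (∀ x > 0, f x = 0) ∨ (∀ x > 0, g x = 0) := by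
  have hpow : ∀ n : ℕ, ∀ x > 0, laplaceConv f (fun t => t ^ n * g t) x = 0 := by
    intro n
    induction n with
    | zero => simpa using hfg
    | succ n ih =>
      have := laplaceConv_id_mul_eq_zero hf (by fun_prop) ih
      simpa only [pow_succ', mul_assoc] using this
  by_contra! ⟨⟨a, ha, hfa⟩, b, hb, hgb⟩
  have := eqOn_zero_of_polynomial_moments (φ := fun t => f (a + b - t) * g t) (by fun_prop)
    (add_pos ha hb) (fun n => ?_) b ⟨hb, by linarith⟩
  · rw [add_sub_cancel_right] at this
    exact mul_ne_zero hfa hgb this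
  · simpa only [laplaceConv, mul_left_comm] using hpow n (a + b) (add_pos ha hb)

theorem SpaceC.exists_intervalIntegrable {f : ℝ → ℝ} (hf : SpaceC (-1) f) :
    ∃ F : ℝ → ℝ, (∀ a b, IntervalIntegrable F volume a b) ∧ ContinuousOn F (Ioi 0) ∧
      EqOn F f (Ioi 0) := by
  obtain ⟨p, hp, f₁, hf₁, hff₁⟩ := hf
  have hc : Continuous fun x : ℝ => f₁ |x| :=
    hf₁.comp_continuous continuous_abs fun x => abs_nonneg x
  refine ⟨fun x => x ^ p * f₁ |x|, fun a b =>
    (intervalIntegral.intervalIntegrable_rpow' hp).mul_continuousOn hc.continuousOn, ?_, ?_⟩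
  · exact (continuousOn_id.rpow_const fun x hx => Or.inl (ne_of_gt hx)).mul hc.continuousOn
  · intro x hx
    simp only [abs_of_pos (mem_Ioi.1 hx), hff₁ x hx]

theorem eq_zero_of_primitive_eq_zero {F : ℝ → ℝ} (hF : ∀ a b, IntervalIntegrable F volume a b)
    (hc : ContinuousOn F (Ioi 0)) (h0 : ∀ x > 0, ∫ t in (0:ℝ)..x, F t = 0) :
    ∀ x > 0, F x = 0 := by
  intro x hx
  have d : HasDerivAt (fun a => ∫ t in (0:ℝ)..a, F t) (F x) x :=
    intervalIntegral.integral_hasDerivAt_right (hF _ _)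
      (hc.stronglyMeasurableAtFilter isOpen_Ioi x hx) (hc.continuousAt (Ioi_mem_nhds hx))
  refine d.unique ((hasDerivAt_const x (0 : ℝ)).congr_of_eventuallyEq ?_)
  filter_upwards [Ioi_mem_nhds hx] with a ha using h0 a ha

/-- `(C_{-1}, ⋆, +)` has no divisors of zero. -/
theorem C_neg_one_no_zero_divisors (f g : ℝ → ℝ)
    (hf : SpaceC (-1) f) (hg : SpaceC (-1) g)
    (hfg : ∀ x > 0, laplaceConv f g x = 0) :
    (∀ x > 0, f x = 0) ∨ (∀ x > 0, g x = 0) := by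
  obtain ⟨F, iF, cF, eF⟩ := hf.exists_intervalIntegrable
  obtain ⟨G, iG, cG, eG⟩ := hg.exists_intervalIntegrable
  have hFG : ∀ x > 0, laplaceConv F G x = 0 := fun x hx => by
    rw [laplaceConv_congr_s5 hx (eF.mono Ioo_subset_Ioi_self) (eG.mono Ioo_subset_Ioi_self), hfg x hx]
  have hprim : ∀ H : ℝ → ℝ, laplaceConv (fun _ => 1) H = fun x => ∫ t in (0:ℝ)..x, H t :=
    fun H => by funext x; simp [laplaceConv]
  have cont : ∀ {H : ℝ → ℝ}, (∀ a b, IntervalIntegrable H volume a b) →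
      Continuous (laplaceConv (fun _ => 1) H) := fun {H} iH => by
    rw [hprim]
    exact intervalIntegral.continuous_primitive iH 0
  have hFG₁ : ∀ x > 0, laplaceConv F (laplaceConv (fun _ => 1) G) x = 0 := fun x hx => by
    rw [funext (laplaceConv_comm (fun _ => 1) G),
      ← laplaceConv_assoc hx (iF _ _) (iG _ _) continuous_const,
      laplaceConv_congr_s5 hx (f' := fun _ => 0) (fun t ht => hFG t ht.1) (fun _ _ => rfl),
      laplaceConv_zero_left]
  have hprims : ∀ x > 0,
      laplaceConv (laplaceConv (fun _ => 1) F) (laplaceConv (fun _ => 1) G) x = 0 := fun x hx => by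
    rw [laplaceConv_assoc hx intervalIntegrable_const (iF _ _) (cont iG), laplaceConv_comm,
      laplaceConv_congr_s5 hx (f' := fun _ => 0) (fun t ht => hFG₁ t ht.1) (fun _ _ => rfl),
      laplaceConv_zero_left]
  refine (eq_zero_or_eq_zero_of_laplaceConv_eq_zero (cont iF) (cont iG) hprims).imp
    (fun h x hx => ?_) fun h x hx => ?_
  · rw [← eF hx]
    exact eq_zero_of_primitive_eq_zero iF cF (by simpa only [hprim] using h) x hx
  · rw [← eG hx]
    exact eq_zero_of_primitive_eq_zero iG cG (by simpa only [hprim] using h) x hx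
end

section
/- For a_1, …, a_n > 0 and b > 0, the double series defining the multivariate Mittag-Leffler function E_{(a_1,…,a_n),b}(z_1,…,z_n) converges absolutely for every (z_1,…,z_n) ∈ ℂⁿ. -/
open Real MeasureTheory Filter Set Topology

/-- The Gamma function dominates every exponential `M ^ x`, with an explicit constant. -/
theorem Real.rpow_mul_exp_div_le_Gamma {M x : ℝ} (hM : 0 < M) (hx : 0 < x) :
    M ^ x * (Real.exp (-(M + 1)) / (M + 1)) ≤ Real.Gamma x := by
  have hint := Real.GammaIntegral_convergent hx
  have hsub : Set.Ioc M (M + 1) ⊆ Set.Ioi 0 := fun t ht => hM.trans ht.1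
  rw [Real.Gamma_eq_integral hx]
  calc M ^ x * (Real.exp (-(M + 1)) / (M + 1))
      = ∫ _ in Set.Ioc M (M + 1), M ^ x * (Real.exp (-(M + 1)) / (M + 1)) := by simp
    _ ≤ ∫ t in Set.Ioc M (M + 1), Real.exp (-t) * t ^ (x - 1) := by
        refine setIntegral_mono_on (integrableOn_const (by simp)) (hint.mono_set hsub) measurableSet_Ioc
          fun t ht => ?_
        have ht0 : 0 < t := hsub ht
        rw [Real.rpow_sub_one ht0.ne']
        calc M ^ x * (Real.exp (-(M + 1)) / (M + 1))
            ≤ t ^ x * (Real.exp (-t) / t) := by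
              gcongr
              exacts [ht.1.le, ht.2, ht.2]
          _ = Real.exp (-t) * (t ^ x / t) := by ring
    _ ≤ ∫ t in Set.Ioi 0, Real.exp (-t) * t ^ (x - 1) := by
        refine setIntegral_mono_set hint ?_ hsub.eventuallyLE
        filter_upwards [ae_restrict_mem measurableSet_Ioi] with t ht
        have : 0 < t := ht
        simp only [Pi.zero_apply]
        positivity

/-- A multinomial coefficient is at most the number of words it is counted among. -/
theorem Nat.multinomial_univ_le_card_pow {ι : Type*} [Fintype ι] (l : ι → ℕ) :
    Nat.multinomial Finset.univ l ≤ Fintype.card ι ^ ∑ j, l j := by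
  classical
  have h := Finset.sum_pow_eq_sum_piAntidiag (Finset.univ : Finset ι) (fun _ => (1 : ℕ)) (∑ j, l j)
  simp only [Finset.sum_const, Finset.card_univ, smul_eq_mul, mul_one, one_pow,
    Finset.prod_const_one, Nat.cast_id] at h
  rw [h]
  exact Finset.single_le_sum (f := fun k => Nat.multinomial Finset.univ k)
    (fun _ _ => Nat.zero_le _) (by simp)

/-- Products of terms of a nonnegative summable sequence are summable over multi-indices. -/
theorem Summable.prod_apply_of_nonneg {ι : Type*} [Fintype ι] {f : ℕ → ℝ}
    (hf : Summable f) (hf0 : ∀ k, 0 ≤ f k) :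
    Summable fun l : ι → ℕ => ∏ j, f (l j) := by
  classical
  refine summable_of_sum_le (c := ∏ _j : ι, ∑' k, f k)
    (fun l => Finset.prod_nonneg fun j _ => hf0 _) fun s => ?_
  let t : ι → Finset ℕ := fun j => s.image fun l => l j
  calc ∑ l ∈ s, ∏ j, f (l j)
      ≤ ∑ l ∈ Fintype.piFinset t, ∏ j, f (l j) := by
        refine Finset.sum_le_sum_of_subset_of_nonneg (fun l hl => ?_)
          fun l _ _ => Finset.prod_nonneg fun j _ => hf0 _
        exact Fintype.mem_piFinset.2 fun j => Finset.mem_image_of_mem _ hl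
    _ = ∏ j, ∑ k ∈ t j, f k := (Finset.prod_univ_sum t fun _ k => f k).symm
    _ ≤ ∏ _j : ι, ∑' k, f k :=
        Finset.prod_le_prod (fun j _ => Finset.sum_nonneg fun k _ => hf0 k)
          fun j _ => hf.sum_le_tsum _ fun k _ => hf0 k

/-- for `a_1,…,a_n > 0` and `b > 0`, the (double) series defining the
multivariate Mittag-Leffler function converges absolutely for every `(z_1,…,z_n) ∈ ℂⁿ`,
i.e. the family of its terms, indexed by the multi-indices `(l_1,…,l_n)`, is absolutely
summable. -/
theorem mittagLeffler_summable (n : ℕ) (a : Fin n → ℝ) (ha : ∀ j, 0 < a j)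
    (b : ℝ) (hb : 0 < b) (z : Fin n → ℂ) :
    Summable (fun l : Fin n → ℕ =>
      ‖((Nat.factorial (∑ j, l j) : ℂ) / ∏ j, (Nat.factorial (l j) : ℂ)) *
        (∏ j, z j ^ l j) / Complex.Gamma ((b : ℂ) + ∑ j, (a j : ℂ) * (l j : ℂ))‖) := by
  obtain ⟨M, hM, hMa⟩ : ∃ M : ℝ, 0 < M ∧ ∀ j, 2 * (n * ‖z j‖) ≤ M ^ a j :=
    ((eventually_gt_atTop 0).and (eventually_all.2 fun j =>
      (tendsto_rpow_atTop (ha j)).eventually_ge_atTop _)).exists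
  set c : ℝ := M ^ b * (Real.exp (-(M + 1)) / (M + 1))
  have hc0 : 0 < c := by positivity
  refine Summable.of_nonneg_of_le (fun _ => norm_nonneg _) (fun l => ?_)
    ((summable_geometric_two.prod_apply_of_nonneg
      (ι := Fin n) fun k => by positivity).mul_left c⁻¹)
  have hx : 0 < b + ∑ j, a j * l j :=
    add_pos_of_pos_of_nonneg hb (Finset.sum_nonneg fun j _ => by have := ha j; positivity)
  have hGamma : c * ∏ j, (M ^ a j) ^ l j ≤ Real.Gamma (b + ∑ j, a j * l j) := by
    refine le_of_eq_of_le ?_ (Real.rpow_mul_exp_div_le_Gamma hM hx)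
    rw [Real.rpow_add hM, Real.rpow_sum_of_pos hM]
    simp only [Real.rpow_mul_natCast hM.le]
    ring
  have hmult : (Nat.factorial (∑ j, l j) : ℝ) / ∏ j, (Nat.factorial (l j) : ℝ)
      ≤ ∏ j, (n : ℝ) ^ l j := by
    rw [Finset.prod_pow_eq_pow_sum, div_le_iff₀ (by positivity), mul_comm,
      ← Nat.multinomial_spec Finset.univ l]
    push_cast
    gcongr
    exact_mod_cast (Nat.multinomial_univ_le_card_pow l).trans_eq (by simp)
  have hnorm : ‖Complex.Gamma ((b : ℂ) + ∑ j, (a j : ℂ) * (l j : ℂ))‖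
      = Real.Gamma (b + ∑ j, a j * l j) := by
    have : (b : ℂ) + ∑ j, (a j : ℂ) * (l j : ℂ) = ((b + ∑ j, a j * l j : ℝ) : ℂ) := by
      push_cast; rfl
    rw [this, Complex.Gamma_ofReal, Complex.norm_real, Real.norm_of_nonneg
      (Real.Gamma_pos_of_pos hx).le]
  rw [norm_div, hnorm, div_le_iff₀ (Real.Gamma_pos_of_pos hx)]
  simp only [norm_mul, norm_div, norm_prod, norm_pow, Complex.norm_natCast]
  calc (Nat.factorial (∑ j, l j) : ℝ) / (∏ j, (Nat.factorial (l j) : ℝ)) * ∏ j, ‖z j‖ ^ l j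
      ≤ (∏ j, (n : ℝ) ^ l j) * ∏ j, ‖z j‖ ^ l j := by gcongr
    _ = ∏ j, (n * ‖z j‖) ^ l j := by simp only [mul_pow, Finset.prod_mul_distrib]
    _ ≤ ∏ j, ((1 / 2 : ℝ) * M ^ a j) ^ l j := by
        refine Finset.prod_le_prod (fun j _ => by positivity) fun j _ => ?_
        exact pow_le_pow_left₀ (by positivity) (by linarith [hMa j]) _
    _ = c⁻¹ * (∏ j, (1 / 2 : ℝ) ^ l j) * (c * ∏ j, (M ^ a j) ^ l j) := by
        simp only [mul_pow, Finset.prod_mul_distrib]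
        field_simp
    _ ≤ c⁻¹ * (∏ j, (1 / 2 : ℝ) ^ l j) * Real.Gamma (b + ∑ j, a j * l j) := by gcongr
end

section
/- Let α > 0, β > 0, α_1, …, α_n > 0 and λ_1, …, λ_n ∈ ℝ, and set h_μ(x) = x^{μ−1}/Γ(μ) for μ > 0. Define u(x) = x^{βα−1} E_{(α_1α, …, α_nα), βα}(λ_1 x^{α_1α}, …, λ_n x^{α_nα}) for x > 0. Then u ∈ C_{−1} and u(x) − Σ_{i=1}^n λ_i (h_{α_i α} ⋆ u)(x) = h_{βα}(x) for all x > 0; that is, u represents the convolution quotient s_α^β / (I − Σ_{i=1}^n λ_i s_α^{−α_i}) in the ring C_{−1}. -/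
open Real MeasureTheory Filter Set Topology

/-- The power function `h_μ(x) = x^{μ-1}/Γ(μ)`. -/
noncomputable def hfun (μ : ℝ) : ℝ → ℝ := fun x => x ^ (μ - 1) / Real.Gamma μ

lemma hfun_pos {μ x : ℝ} (hμ : 0 < μ) (hx : 0 < x) : 0 < hfun μ x :=
  div_pos (rpow_pos_of_pos hx _) (Gamma_pos_of_pos hμ)

/-- The semigroup property of the power functions under Laplace convolution. -/
lemma laplaceConv_hfun {μ ν x : ℝ} (hμ : 0 < μ) (hν : 0 < ν) (hx : 0 < x) :
    laplaceConv (hfun μ) (hfun ν) x = hfun (μ + ν) x := by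
  have hscaled := Complex.betaIntegral_scaled (ν : ℂ) (μ : ℂ) hx
  have hbeta := Complex.Gamma_mul_Gamma_eq_betaIntegral (s := (ν : ℂ)) (t := (μ : ℂ))
    (by simpa using hν) (by simpa using hμ)
  have hsum := (Gamma_pos_of_pos (add_pos hμ hν)).ne'
  have hreal : ∫ t in (0:ℝ)..x, (t : ℂ) ^ ((ν : ℂ) - 1) * ((x : ℂ) - t) ^ ((μ : ℂ) - 1) =
      ((∫ t in (0:ℝ)..x, t ^ (ν - 1) * (x - t) ^ (μ - 1) : ℝ) : ℂ) := by
    rw [← intervalIntegral.integral_ofReal]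
    refine intervalIntegral.integral_congr fun t ht => ?_
    rw [uIcc_of_le hx.le] at ht
    simp only [Complex.ofReal_mul]
    rw [Complex.ofReal_cpow ht.1, Complex.ofReal_cpow (sub_nonneg.2 ht.2)]
    push_cast
    rfl
  have hI : Gamma (μ + ν) * ∫ t in (0:ℝ)..x, t ^ (ν - 1) * (x - t) ^ (μ - 1) =
      x ^ (μ + ν - 1) * (Gamma ν * Gamma μ) := by
    have hpow : (x : ℂ) ^ ((ν : ℂ) + μ - 1) = ((x ^ (μ + ν - 1) : ℝ) : ℂ) := by
      rw [Complex.ofReal_cpow hx.le]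
      push_cast
      rw [add_comm]
    rw [hreal, hpow] at hscaled
    rw [← Complex.ofReal_add, Complex.Gamma_ofReal, Complex.Gamma_ofReal,
      Complex.Gamma_ofReal, add_comm ν μ] at hbeta
    apply Complex.ofReal_injective
    push_cast
    rw [hscaled, hbeta]
    ring
  have hfactor : laplaceConv (hfun μ) (hfun ν) x =
      (Gamma μ * Gamma ν)⁻¹ * ∫ t in (0:ℝ)..x, t ^ (ν - 1) * (x - t) ^ (μ - 1) := by
    rw [laplaceConv, ← intervalIntegral.integral_const_mul]
    refine intervalIntegral.integral_congr fun t _ => ?_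
    simp only [hfun, div_eq_mul_inv, mul_inv]
    ring
  have hμ' := (Gamma_pos_of_pos hμ).ne'
  have hν' := (Gamma_pos_of_pos hν).ne'
  rw [hfactor, hfun]
  field_simp
  linear_combination hI

/-- `Γ (b + s)` grows faster than every exponential in `s`. -/
lemma exists_mul_rpow_le_Gamma {b Y : ℝ} (hb : 0 < b) (hY : 0 < Y) :
    ∃ c > 0, ∀ s ≥ 0, c * Y ^ s ≤ Gamma (b + s) := by
  have hsub : Ioi Y ⊆ Ioi (0 : ℝ) := Ioi_subset_Ioi hY.le
  have hintegrable := GammaIntegral_convergent hb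
  refine ⟨∫ t in Ioi Y, exp (-t) * t ^ (b - 1), ?_, fun s hs => ?_⟩
  · rw [gt_iff_lt, setIntegral_pos_iff_support_of_nonneg_ae]
    · refine lt_of_lt_of_le ?_ (measure_mono (s := Ioi Y) fun t ht => ?_)
      · simp
      · have : 0 < t := hsub ht
        exact ⟨by simp; positivity, ht⟩
    · filter_upwards [ae_restrict_mem measurableSet_Ioi] with t ht
      have : 0 < t := hsub ht
      simp only [Pi.zero_apply]
      positivity
    · exact hintegrable.mono_set hsub
  · have hintegrable' := GammaIntegral_convergent (add_pos_of_pos_of_nonneg hb hs)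
    rw [Gamma_eq_integral (add_pos_of_pos_of_nonneg hb hs), ← integral_mul_const]
    refine (setIntegral_mono_on ((hintegrable.mono_set hsub).mul_const _) (hintegrable'.mono_set hsub)
      measurableSet_Ioi fun t ht => ?_).trans (setIntegral_mono_set hintegrable' ?_ hsub.eventuallyLE)
    · have ht0 : 0 < t := hsub ht
      rw [mul_assoc, show b + s - 1 = (b - 1) + s by ring, rpow_add ht0]
      gcongr
      exact le_of_lt ht
    · filter_upwards [ae_restrict_mem measurableSet_Ioi] with t ht
      have : 0 < t := ht
      simp only [Pi.zero_apply]
      positivity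

/-- The general term of the multinomial expansion of `∑ k, (∑ j, z j) ^ k`. -/
noncomputable def multinomialTerm {ι : Type*} [Fintype ι] (z : ι → ℝ) (l : ι → ℕ) : ℝ :=
  (Nat.factorial (∑ j, l j) : ℝ) / (∏ j, (Nat.factorial (l j) : ℝ)) * ∏ j, z j ^ l j

lemma multinomialTerm_eq {ι : Type*} [Fintype ι] (z : ι → ℝ) (l : ι → ℕ) :
    multinomialTerm z l = Nat.multinomial Finset.univ l * ∏ j, z j ^ l j := by
  rw [multinomialTerm, ← Nat.multinomial_spec]
  push_cast
  rw [mul_div_cancel_left₀ _ (Finset.prod_ne_zero_iff.2 fun j _ => by positivity)]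

lemma multinomialTerm_nonneg {ι : Type*} [Fintype ι] {z : ι → ℝ} (hz : ∀ j, 0 ≤ z j)
    (l : ι → ℕ) : 0 ≤ multinomialTerm z l :=
  mul_nonneg (by positivity) (Finset.prod_nonneg fun j _ => pow_nonneg (hz j) _)

lemma multinomialTerm_mul {ι : Type*} [Fintype ι] (z w : ι → ℝ) (l : ι → ℕ) :
    multinomialTerm (fun j => z j * w j) l = multinomialTerm z l * ∏ j, w j ^ l j := by
  simp only [multinomialTerm, mul_pow, Finset.prod_mul_distrib, mul_assoc]

lemma abs_multinomialTerm {ι : Type*} [Fintype ι] (z : ι → ℝ) (l : ι → ℕ) :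
    |multinomialTerm z l| = multinomialTerm (fun j => |z j|) l := by
  rw [multinomialTerm, abs_mul, abs_of_nonneg (by positivity), Finset.abs_prod]
  simp only [multinomialTerm, abs_pow]

lemma summable_multinomialTerm {ι : Type*} [Fintype ι] {z : ι → ℝ} (hz : ∀ j, 0 ≤ z j)
    (hsum : ∑ j, z j < 1) : Summable (multinomialTerm z) := by
  classical
  have hr : 0 ≤ ∑ j, z j := Finset.sum_nonneg fun j _ => hz j
  have hgeom := summable_geometric_of_lt_one hr hsum
  refine summable_of_sum_le (c := ∑' k : ℕ, (∑ j, z j) ^ k)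
    (fun l => multinomialTerm_nonneg hz l) fun u => ?_
  rw [← Finset.sum_fiberwise_of_maps_to (t := u.image fun l => ∑ j, l j)
    (fun l hl => Finset.mem_image_of_mem _ hl)]
  refine (Finset.sum_le_sum fun k _ => ?_).trans
    (hgeom.sum_le_tsum _ fun k _ => pow_nonneg hr k)
  rw [Finset.sum_pow_eq_sum_piAntidiag]
  simp_rw [← multinomialTerm_eq]
  refine Finset.sum_le_sum_of_subset_of_nonneg (fun l hl => ?_)
    fun l _ _ => multinomialTerm_nonneg hz l
  simpa using (Finset.mem_filter.1 hl).2

/-- The Mittag-Leffler series converges absolutely. -/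
lemma summable_abs_multinomialTerm_div_Gamma {ι : Type*} [Fintype ι] {a : ι → ℝ}
    (ha : ∀ j, 0 < a j) {b : ℝ} (hb : 0 < b) (z : ι → ℝ) :
    Summable fun l : ι → ℕ => |multinomialTerm z l / Gamma (b + ∑ j, a j * l j)| := by
  obtain ⟨Y, hY, hYsum⟩ : ∃ Y > 0, ∑ j, |z j| * Y ^ (-a j) < 1 := by
    have hlim : Tendsto (fun Y : ℝ => ∑ j, |z j| * Y ^ (-a j)) atTop (𝓝 0) := by
      have := tendsto_finsetSum Finset.univ fun j _ =>
        (tendsto_rpow_neg_atTop (ha j)).const_mul |z j|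
      simpa using this
    exact ((eventually_gt_atTop 0).and (hlim.eventually (gt_mem_nhds one_pos))).exists
  obtain ⟨c, hc, hΓ⟩ := exists_mul_rpow_le_Gamma hb hY
  refine Summable.of_nonneg_of_le (fun _ => abs_nonneg _) (fun l => ?_)
    ((summable_multinomialTerm (fun j => by positivity) hYsum).mul_left c⁻¹)
  have hs : 0 ≤ ∑ j, a j * l j :=
    Finset.sum_nonneg fun j _ => mul_nonneg (ha j).le (Nat.cast_nonneg _)
  have hprod : ∏ j, (Y ^ (-a j)) ^ l j = (Y ^ ∑ j, a j * l j)⁻¹ := by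
    rw [rpow_sum_of_pos hY, ← Finset.prod_inv_distrib]
    refine Finset.prod_congr rfl fun j _ => ?_
    rw [← rpow_natCast, ← rpow_mul hY.le, neg_mul, rpow_neg hY.le]
  have hYs : 0 < Y ^ ∑ j, a j * l j := rpow_pos_of_pos hY _
  rw [multinomialTerm_mul, hprod, abs_div, abs_multinomialTerm,
    abs_of_pos (Gamma_pos_of_pos (add_pos_of_pos_of_nonneg hb hs)), mul_left_comm, ← mul_inv,
    ← div_eq_mul_inv]
  exact div_le_div_of_nonneg_left (multinomialTerm_nonneg (fun j => abs_nonneg _) l)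
    (by positivity) (hΓ _ hs)

lemma multinomialTerm_zero {ι : Type*} [Fintype ι] (z : ι → ℝ) : multinomialTerm z 0 = 1 := by
  simp [multinomialTerm]

/-- Share of `multinomialTerm z m` coming from words whose first letter is `j`. -/
noncomputable def multinomialShare {ι : Type*} [Fintype ι] (z : ι → ℝ) (j : ι) (m : ι → ℕ) : ℝ :=
  (m j : ℝ) / ((∑ i, m i : ℕ) : ℝ) * multinomialTerm z m

lemma multinomialShare_add_single {ι : Type*} [Fintype ι] [DecidableEq ι] (z : ι → ℝ) (j : ι)
    (l : ι → ℕ) : multinomialShare z j (l + Pi.single j 1) = z j * multinomialTerm z l := by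
  have hsum : ∑ i, (l + Pi.single j 1 : ι → ℕ) i = ∑ i, l i + 1 := by
    simp [Finset.sum_add_distrib]
  have hfac : ∏ i, (Nat.factorial ((l + Pi.single j 1 : ι → ℕ) i) : ℝ) =
      (l j + 1) * ∏ i, (Nat.factorial (l i) : ℝ) := by
    rw [← Finset.mul_prod_erase _ _ (Finset.mem_univ j),
      ← Finset.mul_prod_erase _ (fun i => (Nat.factorial (l i) : ℝ)) (Finset.mem_univ j),
      Finset.prod_congr rfl (g := fun i => (Nat.factorial (l i) : ℝ)) fun i hi => by
        simp [Finset.ne_of_mem_erase hi]]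
    simp [Nat.factorial_succ, mul_assoc]
  have hpow : ∏ i, z i ^ (l + Pi.single j 1 : ι → ℕ) i = z j * ∏ i, z i ^ l i := by
    simp only [Pi.add_apply, pow_add, Finset.prod_mul_distrib, Pi.single_apply]
    simp [pow_ite, mul_comm]
  have hne : (∏ i, (Nat.factorial (l i) : ℝ)) ≠ 0 :=
    Finset.prod_ne_zero_iff.2 fun j _ => by positivity
  rw [multinomialShare, multinomialTerm, multinomialTerm, hsum, hfac, hpow, Nat.factorial_succ]
  simp only [Pi.add_apply, Pi.single_eq_same]
  have h1 : (((∑ i, l i : ℕ) : ℝ) + 1) ≠ 0 := by positivity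
  have h2 : ((l j : ℝ) + 1) ≠ 0 := by positivity
  rw [Nat.cast_add, Nat.cast_mul, Nat.cast_add, Nat.cast_one]
  field_simp

lemma sum_multinomialShare {ι : Type*} [Fintype ι] (z : ι → ℝ) {m : ι → ℕ} (hm : m ≠ 0) :
    ∑ j, multinomialShare z j m = multinomialTerm z m := by
  have hne : ((∑ i, m i : ℕ) : ℝ) ≠ 0 := by
    rw [Nat.cast_ne_zero]
    intro h
    exact hm (funext fun i => (Finset.sum_eq_zero_iff.1 h) i (Finset.mem_univ i))
  simp only [multinomialShare]
  rw [← Finset.sum_mul, ← Finset.sum_div, ← Nat.cast_sum, div_self hne, one_mul]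

lemma abs_multinomialShare_le {ι : Type*} [Fintype ι] (z : ι → ℝ) (j : ι) (m : ι → ℕ) :
    |multinomialShare z j m| ≤ |multinomialTerm z m| := by
  rw [multinomialShare, abs_mul, abs_of_nonneg (by positivity)]
  refine mul_le_of_le_one_left (abs_nonneg _) (div_le_one_of_le₀ ?_ (Nat.cast_nonneg _))
  exact_mod_cast Finset.single_le_sum (fun i _ => Nat.zero_le (m i)) (Finset.mem_univ j)

/-- Splitting the multinomial series according to the first letter of a word. -/
lemma tsum_multinomialTerm_mul {ι : Type*} [Fintype ι] [DecidableEq ι] (z : ι → ℝ)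
    (F : (ι → ℕ) → ℝ) (hF : Summable fun l => |multinomialTerm z l * F l|) :
    ∑' l, multinomialTerm z l * F l =
      F 0 + ∑ j, z j * ∑' l, multinomialTerm z l * F (l + Pi.single j 1) := by
  have hshare (j : ι) : Summable fun m => multinomialShare z j m * F m := by
    refine Summable.of_abs (hF.of_nonneg_of_le (fun _ => abs_nonneg _) fun m => ?_)
    rw [abs_mul, abs_mul]
    exact mul_le_mul_of_nonneg_right (abs_multinomialShare_le z j m) (abs_nonneg _)
  have hshift (j : ι) : z j * ∑' l, multinomialTerm z l * F (l + Pi.single j 1) =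
      ∑' m, multinomialShare z j m * F m := by
    rw [← tsum_mul_left, ← (add_left_injective (Pi.single j 1 : ι → ℕ)).tsum_eq
      (f := fun m => multinomialShare z j m * F m)]
    · simp only [multinomialShare_add_single, mul_assoc]
    · intro m hm
      have hmj : m j ≠ 0 := fun h => hm (by simp [multinomialShare, h])
      refine ⟨m - Pi.single j 1, funext fun i => ?_⟩
      rcases eq_or_ne i j with rfl | hij
      · simp only [Pi.add_apply, Pi.sub_apply, Pi.single_eq_same]
        omega
      · simp [hij]
  have hsplit (l : ι → ℕ) : multinomialTerm z l * F l =
      (if l = 0 then F 0 else 0) + ∑ j, multinomialShare z j l * F l := by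
    split_ifs with hl
    · subst hl
      simp [multinomialTerm_zero, multinomialShare]
    · rw [← Finset.sum_mul, sum_multinomialShare z hl, zero_add]
  have hzero : HasSum (fun l : ι → ℕ => if l = 0 then F 0 else 0) (F 0) := hasSum_ite_eq 0 (F 0)
  simp_rw [hshift, hsplit]
  rw [hzero.summable.tsum_add (summable_sum fun j _ => hshare j), hzero.tsum_eq,
    Summable.tsum_finsetSum fun j _ => hshare j]

lemma rpow_mul_multinomialTerm_div_Gamma {ι : Type*} [Fintype ι] (a lam : ι → ℝ) (b : ℝ)
    {x : ℝ} (hx : 0 < x) (l : ι → ℕ) :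
    x ^ (b - 1) * (multinomialTerm (fun j => lam j * x ^ a j) l / Gamma (b + ∑ j, a j * l j)) =
      multinomialTerm lam l * hfun (b + ∑ j, a j * l j) x := by
  have hprod : ∏ j, (x ^ a j) ^ l j = x ^ ∑ j, a j * l j := by
    rw [rpow_sum_of_pos hx]
    refine Finset.prod_congr rfl fun j _ => ?_
    rw [rpow_mul hx.le, rpow_natCast]
  rw [multinomialTerm_mul, hprod, hfun, add_sub_right_comm, rpow_add hx]
  ring

lemma summable_abs_multinomialTerm_mul_hfun {ι : Type*} [Fintype ι] {a : ι → ℝ}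
    (ha : ∀ j, 0 < a j) {b : ℝ} (hb : 0 < b) (lam : ι → ℝ) {x : ℝ} (hx : 0 < x) :
    Summable fun l : ι → ℕ => |multinomialTerm lam l * hfun (b + ∑ j, a j * l j) x| := by
  simp_rw [← rpow_mul_multinomialTerm_div_Gamma a lam b hx, abs_mul (x ^ (b - 1))]
  exact (summable_abs_multinomialTerm_div_Gamma ha hb _).mul_left _

lemma rpow_mul_mittagLeffler {n : ℕ} (a lam : Fin n → ℝ) (b : ℝ) {x : ℝ} (hx : 0 < x) :
    x ^ (b - 1) * mittagLeffler a b (fun j => lam j * x ^ a j) =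
      ∑' l : Fin n → ℕ, multinomialTerm lam l * hfun (b + ∑ j, a j * l j) x := by
  simp_rw [← rpow_mul_multinomialTerm_div_Gamma a lam b hx]
  rw [tsum_mul_left]
  rfl

lemma continuous_mittagLeffler_rpow {n : ℕ} {a : Fin n → ℝ} (ha : ∀ j, 0 < a j) {b : ℝ}
    (hb : 0 < b) (lam : Fin n → ℝ) :
    Continuous fun x : ℝ => mittagLeffler a b fun j => lam j * x ^ a j := by
  refine continuous_iff_continuousAt.2 fun x₀ => ?_
  have hball : Metric.ball (0 : ℝ) (|x₀| + 1) ∈ 𝓝 x₀ :=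
    Metric.isOpen_ball.mem_nhds (by simp)
  refine ContinuousOn.continuousAt ?_ hball
  refine continuousOn_tsum (fun l => Continuous.continuousOn ?_)
    (summable_abs_multinomialTerm_div_Gamma ha hb fun j => lam j * (|x₀| + 1) ^ a j)
    fun l x hx => ?_
  · refine (continuous_const.mul (continuous_finsetProd _ fun j _ => ?_)).div_const _
    exact (continuous_const.mul (continuous_rpow_const (ha j).le)).pow _
  · change |multinomialTerm (fun j => lam j * x ^ a j) l / Gamma (b + ∑ j, a j * l j)| ≤ _
    rw [abs_div, abs_div, abs_multinomialTerm, abs_multinomialTerm]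
    have hx' : |x| ≤ |x₀| + 1 := by
      simpa using (Metric.mem_ball.1 hx).le
    have hle (j : Fin n) : |lam j * x ^ a j| ≤ |lam j * (|x₀| + 1) ^ a j| := by
      rw [abs_mul, abs_mul, abs_of_nonneg (rpow_nonneg (by positivity : 0 ≤ |x₀| + 1) _)]
      gcongr
      exact (abs_rpow_le_abs_rpow x (a j)).trans (rpow_le_rpow (abs_nonneg x) hx' (ha j).le)
    unfold multinomialTerm
    gcongr with j
    exact hle j

/-- Convolution with a power function acts termwise on a series of power functions. -/
lemma laplaceConv_hfun_tsum {κ : Type*} [Countable κ] {C ν : κ → ℝ} (hν : ∀ k, 0 < ν k)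
    {μ x : ℝ} (hμ : 0 < μ) (hx : 0 < x) {u : ℝ → ℝ}
    (hu : ∀ t > 0, u t = ∑' k, C k * hfun (ν k) t)
    (hC : Summable fun k => |C k * hfun (μ + ν k) x|) :
    laplaceConv (hfun μ) u x = ∑' k, C k * hfun (μ + ν k) x := by
  have hconv (k : κ) : ∫ t in (0:ℝ)..x, hfun μ (x - t) * hfun (ν k) t = hfun (μ + ν k) x :=
    laplaceConv_hfun hμ (hν k) hx
  have hintegrable (k : κ) :
      IntervalIntegrable (fun t => hfun μ (x - t) * hfun (ν k) t) volume 0 x :=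
    intervalIntegral.intervalIntegrable_of_integral_ne_zero
      ((hconv k).trans_ne (hfun_pos (add_pos hμ (hν k)) hx).ne')
  have hnonneg {ρ t : ℝ} (hρ : 0 < ρ) (ht : 0 ≤ t) : 0 ≤ hfun ρ t :=
    div_nonneg (rpow_nonneg ht _) (Gamma_pos_of_pos hρ).le
  have hterm (k : κ) :
      ∫ t in Ioc 0 x, C k * (hfun μ (x - t) * hfun (ν k) t) = C k * hfun (μ + ν k) x := by
    rw [integral_const_mul, ← intervalIntegral.integral_of_le hx.le, hconv]
  have hnorm (k : κ) : ∫ t in Ioc 0 x, ‖C k * (hfun μ (x - t) * hfun (ν k) t)‖ =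
      |C k * hfun (μ + ν k) x| := by
    rw [abs_mul, abs_of_pos (hfun_pos (add_pos hμ (hν k)) hx), ← hconv k,
      intervalIntegral.integral_of_le hx.le, ← integral_const_mul]
    refine setIntegral_congr_fun measurableSet_Ioc fun t ht => ?_
    simp only [norm_mul, norm_eq_abs]
    rw [abs_of_nonneg (hnonneg hμ (sub_nonneg.2 ht.2)), abs_of_nonneg (hnonneg (hν k) ht.1.le)]
  rw [laplaceConv, intervalIntegral.integral_of_le hx.le]
  simp_rw [← hterm]
  rw [integral_tsum_of_summable_integral_norm
    (fun k => ((intervalIntegrable_iff_integrableOn_Ioc_of_le hx.le).1 (hintegrable k)).const_mul _)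
    (by simpa only [hnorm] using hC)]
  refine setIntegral_congr_fun measurableSet_Ioc fun t ht => ?_
  simp only [hu t ht.1, ← tsum_mul_left]
  exact tsum_congr fun k => by ring

/-- the function
`u(x) = x^{βα-1} E_{(α_1 α,…,α_n α),βα}(λ_1 x^{α_1 α},…,λ_n x^{α_n α})`
belongs to `C_{-1}` and satisfies `u - Σ_i λ_i (h_{α_i α} ⋆ u) = h_{βα}` on `(0,∞)`;
i.e. it represents `s_α^β / (I - Σ_i λ_i s_α^{-α_i})` in `C_{-1}`. -/
theorem ml_represents_convolution_quotient (n : ℕ) (α β : ℝ) (hα : 0 < α) (hβ : 0 < β)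
    (αv : Fin n → ℝ) (hαv : ∀ j, 0 < αv j) (lam : Fin n → ℝ)
    (u : ℝ → ℝ)
    (hu : ∀ x > 0, u x = x ^ (β * α - 1) *
      mittagLeffler (fun j => αv j * α) (β * α) (fun j => lam j * x ^ (αv j * α))) :
    SpaceC (-1) u ∧
    ∀ x > 0, u x - ∑ j, lam j * laplaceConv (hfun (αv j * α)) u x = hfun (β * α) x := by
  have hb : 0 < β * α := mul_pos hβ hα
  have ha (j : Fin n) : 0 < αv j * α := mul_pos (hαv j) hα
  refine ⟨⟨β * α - 1, by linarith, _, (continuous_mittagLeffler_rpow ha hb lam).continuousOn, hu⟩,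
    fun x hx => ?_⟩
  have hseries (t : ℝ) (ht : 0 < t) : u t = ∑' l : Fin n → ℕ,
      multinomialTerm lam l * hfun (β * α + ∑ j, αv j * α * l j) t :=
    (hu t ht).trans (rpow_mul_mittagLeffler (fun j => αv j * α) lam (β * α) ht)
  have hν (l : Fin n → ℕ) : 0 < β * α + ∑ j, αv j * α * l j :=
    add_pos_of_pos_of_nonneg hb
      (Finset.sum_nonneg fun j _ => mul_nonneg (ha j).le (Nat.cast_nonneg _))
  have hconv (j : Fin n) : laplaceConv (hfun (αv j * α)) u x = ∑' l : Fin n → ℕ,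
      multinomialTerm lam l *
        hfun (β * α + ∑ i, αv i * α * ((l + Pi.single j 1 : Fin n → ℕ) i : ℝ)) x := by
    rw [laplaceConv_hfun_tsum hν (ha j) hx hseries]
    · refine tsum_congr fun l => ?_
      congr 2
      simp [mul_add, Finset.sum_add_distrib, Pi.single_apply]
      ring
    · simpa only [add_assoc] using
        summable_abs_multinomialTerm_mul_hfun ha (add_pos (ha j) hb) lam hx
  rw [hseries x hx, tsum_multinomialTerm_mul lam
    (fun l => hfun (β * α + ∑ j, αv j * α * l j) x)
    (summable_abs_multinomialTerm_mul_hfun ha hb lam hx)]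
  simp [hconv]
end
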